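/- Let H be a separable Hilbert space with Hilbert basis (v_k)_{k∈ℕ}, let 0 < λ_1 ≤ λ_2 ≤ ⋯ be a nondecreasing sequence of positive reals, let A be the operator Ah = Σ_k λ_k (h, v_k) v_k defined on {h ∈ H : Σ_k λ_k²|(h, v_k)|² < ∞}, and fix ρ ∈ (0,1), T > 0 and φ ∈ H. If u_1 and u_2 are both solutions of the forward problem (i.e. each u_i : (0,T] → H has ∂_t^ρ u_i and Au_i continuous from (0,T] to H, satisfies ∂_t^ρ u_i(t) + Au_i(t) = 0 on (0,T], and ∂_t^{ρ-1} u_i(t) → φ in H as t → 0⁺), then u_1(t) = u_2(t) for all t ∈ (0,T]. -/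

import Mathlib

open MeasureTheory Filter
open scoped RealInnerProductSpace

/-- The Riemann–Liouville fractional integral of order `σ ∈ (0,1)` of a vector-valued
function `h`:  `∂_t^{-σ} h(t) = (1/Γ(σ)) ∫_0^t (t-ξ)^{σ-1} h(ξ) dξ` (Bochner integral). -/
noncomputable def rlIntegral {H : Type*} [NormedAddCommGroup H] [NormedSpace ℝ H]
    (σ : ℝ) (h : ℝ → H) (t : ℝ) : H :=
  (1 / Real.Gamma σ) • (∫ ξ in (0 : ℝ)..t, ((t - ξ) ^ (σ - 1)) • h ξ)

/-- The Riemann–Liouville fractional derivative of order `ρ ∈ (0,1)`: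
`∂_t^ρ h(t) = (d/dt)[∂_t^{-(1-ρ)} h](t)`. -/
noncomputable def rlDeriv {H : Type*} [NormedAddCommGroup H] [NormedSpace ℝ H]
    (ρ : ℝ) (h : ℝ → H) (t : ℝ) : H :=
  deriv (rlIntegral (1 - ρ) h) t

section Helpers

open Set
open scoped Topology


/-- unnormalised fractional integral -/
noncomputable def FI {E : Type*} [NormedAddCommGroup E] [NormedSpace ℝ E]
    (ρ : ℝ) (f : ℝ → E) (s : ℝ) : E := ∫ ξ in (0:ℝ)..s, ((s - ξ) ^ (-ρ)) • f ξ

noncomputable def Bt (ρ : ℝ) : ℝ := ∫ x in (0:ℝ)..1, (1 - x) ^ (ρ - 1) * x ^ (-ρ)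

lemma ii_rpow_left {a : ℝ} (ha : -1 < a) (ξ t : ℝ) :
    IntervalIntegrable (fun s => (s - ξ) ^ a) volume ξ t := by
  have := (intervalIntegral.intervalIntegrable_rpow' (a := 0) (b := t - ξ) ha).comp_sub_right ξ
  simpa using this

lemma ii_rpow_right {a : ℝ} (ha : -1 < a) (ξ t : ℝ) :
    IntervalIntegrable (fun s => (t - s) ^ a) volume ξ t := by
  have := (intervalIntegral.intervalIntegrable_rpow' (a := t - ξ) (b := 0) ha).comp_sub_left t
  simpa using this

lemma ii_beta {a b : ℝ} (ha : -1 < a) (hb : -1 < b) {ξ t : ℝ} (h : ξ < t) :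
    IntervalIntegrable (fun s => (t - s) ^ a * (s - ξ) ^ b) volume ξ t := by
  set m := (ξ + t) / 2 with hm
  have h1 : ξ < m := by rw [hm]; linarith
  have h2 : m < t := by rw [hm]; linarith
  refine IntervalIntegrable.trans (b := m) ?_ ?_
  · refine (ii_rpow_left hb ξ m).continuousOn_mul ?_
    rw [uIcc_of_le h1.le]
    refine ContinuousOn.rpow_const (by fun_prop) ?_
    intro x hx; left; have := hx.2; intro h0; linarith
  · refine (ii_rpow_right ha m t).mul_continuousOn ?_
    rw [uIcc_of_le h2.le]
    refine ContinuousOn.rpow_const (by fun_prop) ?_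
    intro x hx; left; have := hx.1; intro h0; linarith

lemma beta_int (ρ : ℝ) {ξ t : ℝ} (h : ξ < t) :
    ∫ s in ξ..t, (t - s) ^ (ρ - 1) * (s - ξ) ^ (-ρ) = Bt ρ := by
  have hd : 0 < t - ξ := by linarith
  have := intervalIntegral.smul_integral_comp_mul_add (a := 0) (b := 1)
    (fun s => (t - s) ^ (ρ - 1) * (s - ξ) ^ (-ρ)) (t - ξ) ξ
  simp only [mul_zero, zero_add, mul_one, sub_add_cancel] at this
  rw [← this, Bt, smul_eq_mul, ← intervalIntegral.integral_const_mul]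
  refine intervalIntegral.integral_congr_ae (Eventually.of_forall fun x hx => ?_)
  rw [uIoc_of_le zero_le_one] at hx
  have e1 : t - ((t - ξ) * x + ξ) = (t - ξ) * (1 - x) := by ring
  have e2 : (t - ξ) * x + ξ - ξ = (t - ξ) * x := by ring
  rw [e1, e2, Real.mul_rpow hd.le (by linarith [hx.2]), Real.mul_rpow hd.le hx.1.le]
  have : (t - ξ) * ((t - ξ) ^ (ρ - 1) * (t - ξ) ^ (-ρ)) = 1 := by
    rw [← Real.rpow_add hd]
    nth_rewrite 1 [← Real.rpow_one (t - ξ)]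
    rw [← Real.rpow_add hd]; ring_nf; simp
  calc _ = ((t - ξ) * ((t - ξ) ^ (ρ - 1) * (t - ξ) ^ (-ρ))) * ((1 - x) ^ (ρ - 1) * x ^ (-ρ)) := by ring
    _ = _ := by rw [this, one_mul]

lemma Bt_pos {ρ : ℝ} (h0 : 0 < ρ) (h1 : ρ < 1) : 0 < Bt ρ := by
  have := ii_beta (a := ρ - 1) (b := -ρ) (by linarith) (by linarith) (zero_lt_one (α := ℝ))
  simp only [sub_zero] at this
  refine intervalIntegral.intervalIntegral_pos_of_pos_on this ?_ zero_lt_one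
  intro x hx
  have := hx.1; have := hx.2
  have : 0 < 1 - x := by linarith
  positivity

lemma abel {ρ : ℝ} (h0 : 0 < ρ) (h1 : ρ < 1) {f : ℝ → ℝ} {t : ℝ} (ht : 0 < t)
    (hf : IntervalIntegrable f volume 0 t) :
    IntervalIntegrable (fun s => (t - s) ^ (ρ - 1) * FI ρ f s) volume 0 t ∧
    ∫ s in (0:ℝ)..t, (t - s) ^ (ρ - 1) * FI ρ f s = Bt ρ * ∫ s in (0:ℝ)..t, f s := by
  set μ := volume.restrict (Ioc (0:ℝ) t) with hμ
  have hf' : Integrable f μ := (intervalIntegrable_iff_integrableOn_Ioc_of_le ht.le).1 hf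
  set k : ℝ → ℝ → ℝ := fun s ξ => if ξ < s then (t - s) ^ (ρ - 1) * (s - ξ) ^ (-ρ) else 0 with hk
  set F : ℝ → ℝ → ℝ := fun s ξ => k s ξ * f ξ with hF
  have hkm : Measurable (Function.uncurry k) := by
    refine Measurable.ite (measurableSet_lt (by fun_prop) (by fun_prop)) ?_ measurable_const
    fun_prop
  have hknn : ∀ s ∈ Ioc 0 t, ∀ ξ, 0 ≤ k s ξ := by
    intro s hs ξ
    simp only [hk]; split_ifs with h
    · have := hs.2
      exact mul_nonneg (Real.rpow_nonneg (by linarith) _) (Real.rpow_nonneg (by linarith) _)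
    · exact le_rfl
  have hki : ∀ ξ, (fun s => k s ξ) = indicator (Ioi ξ) (fun s => (t - s) ^ (ρ - 1) * (s - ξ) ^ (-ρ)) := by
    intro ξ; ext s; simp only [hk, indicator, mem_Ioi]
  have hset : ∀ ξ ∈ Ioo 0 t, Ioi ξ ∩ Ioc 0 t = Ioc ξ t := by
    intro ξ hξ; ext s; simp only [mem_inter_iff, mem_Ioi, mem_Ioc]
    have := hξ.1
    constructor
    · rintro ⟨a, b, c⟩; exact ⟨a, c⟩
    · rintro ⟨a, b⟩; exact ⟨a, by linarith, b⟩
  have hk1 : ∀ ξ ∈ Ioo 0 t, Integrable (fun s => k s ξ) μ := by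
    intro ξ hξ
    rw [hki, integrable_indicator_iff measurableSet_Ioi, IntegrableOn, hμ,
      Measure.restrict_restrict measurableSet_Ioi, hset ξ hξ]
    exact (intervalIntegrable_iff_integrableOn_Ioc_of_le hξ.2.le).1
      (ii_beta (by linarith) (by linarith) hξ.2)
  have hk2 : ∀ ξ ∈ Ioo 0 t, ∫ s, k s ξ ∂μ = Bt ρ := by
    intro ξ hξ
    rw [hki, integral_indicator measurableSet_Ioi, hμ,
      Measure.restrict_restrict measurableSet_Ioi, hset ξ hξ,
      ← intervalIntegral.integral_of_le hξ.2.le, beta_int _ hξ.2]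
  have hae : ∀ᵐ ξ ∂μ, ξ ∈ Ioo 0 t := by
    rw [hμ, ← restrict_Ioo_eq_restrict_Ioc]; exact ae_restrict_mem measurableSet_Ioo
  have hae' : ∀ᵐ ξ ∂μ, ξ ∈ Ioc 0 t := ae_restrict_mem measurableSet_Ioc
  have hFm : AEStronglyMeasurable (Function.uncurry F) (μ.prod μ) := by
    exact hkm.aestronglyMeasurable.mul hf'.aestronglyMeasurable.comp_snd
  have hFint : Integrable (Function.uncurry F) (μ.prod μ) := by
    rw [integrable_prod_iff' hFm]
    constructor
    · filter_upwards [hae] with ξ hξ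
      simpa only [Function.uncurry, hF] using (hk1 ξ hξ).mul_const (f ξ)
    · refine (hf'.norm.const_mul (Bt ρ)).congr ?_
      filter_upwards [hae] with ξ hξ
      rw [← hk2 ξ hξ, ← integral_mul_const]
      refine integral_congr_ae ?_
      filter_upwards [hae'] with s hs
      simp only [Function.uncurry, hF, norm_mul, Real.norm_eq_abs, abs_of_nonneg (hknn s hs ξ)]
  have hin : ∀ s ∈ Ioc 0 t, ∫ ξ, F s ξ ∂μ = (t - s) ^ (ρ - 1) * FI ρ f s := by
    intro s hs
    have e : (fun ξ => F s ξ) = indicator (Iio s) (fun ξ => (t - s) ^ (ρ - 1) * ((s - ξ) ^ (-ρ) * f ξ)) := by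
      ext ξ; simp only [hF, hk, indicator, mem_Iio]; split_ifs <;> ring
    have hset : Iio s ∩ Ioc 0 t = Ioo 0 s := by
      ext x; simp only [mem_inter_iff, mem_Iio, mem_Ioc, mem_Ioo]
      have := hs.2
      constructor
      · rintro ⟨a, b, c⟩; exact ⟨b, a⟩
      · rintro ⟨a, b⟩; exact ⟨b, a, by linarith⟩
    rw [e, integral_indicator measurableSet_Iio, hμ, Measure.restrict_restrict measurableSet_Iio,
      hset, restrict_Ioo_eq_restrict_Ioc, ← intervalIntegral.integral_of_le hs.1.le,
      intervalIntegral.integral_const_mul]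
    rfl
  constructor
  · rw [intervalIntegrable_iff_integrableOn_Ioc_of_le ht.le]
    refine hFint.integral_prod_left.congr ?_
    filter_upwards [hae'] with s hs
    exact hin s hs
  · rw [intervalIntegral.integral_of_le ht.le, intervalIntegral.integral_of_le ht.le,
      ← integral_const_mul]
    have := integral_integral_swap hFint
    calc _ = ∫ s, ∫ ξ, F s ξ ∂μ ∂μ := by
          refine integral_congr_ae ?_
          filter_upwards [hae'] with s hs
          exact (hin s hs).symm
      _ = ∫ ξ, ∫ s, F s ξ ∂μ ∂μ := this
      _ = _ := by
          refine integral_congr_ae ?_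
          filter_upwards [hae] with ξ hξ
          simp only [hF]
          rw [integral_mul_const, hk2 ξ hξ]

lemma exp_est {ρ : ℝ} (h0 : 0 < ρ) {ε : ℝ} (hε : 0 < ε) :
    ∃ K : ℝ, 0 < K ∧ ∀ t : ℝ, 0 ≤ t →
      ∫ s in (0:ℝ)..t, (t - s) ^ (ρ - 1) * Real.exp (K * s) ≤ ε * Real.exp (K * t) := by
  have hG := Real.Gamma_pos_of_pos h0
  have hlim : Tendsto (fun K : ℝ => (1 / K) ^ ρ * Real.Gamma ρ) atTop (𝓝 0) := by
    have h1 : Tendsto (fun K : ℝ => (1 / K)) atTop (𝓝 0) := by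
      simpa using tendsto_inv_atTop_zero (𝕜 := ℝ)
    have := (h1.rpow_const (p := ρ) (Or.inr h0.le)).mul_const (Real.Gamma ρ)
    simpa [Real.zero_rpow h0.ne'] using this
  obtain ⟨K, hK1, hK2⟩ := ((hlim.eventually (gt_mem_nhds hε)).and (eventually_gt_atTop 0)).exists
  refine ⟨K, hK2, fun t ht => ?_⟩
  have e : ∫ s in (0:ℝ)..t, (t - s) ^ (ρ - 1) * Real.exp (K * s)
      = Real.exp (K * t) * ∫ x in (0:ℝ)..t, x ^ (ρ - 1) * Real.exp (-(K * x)) := by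
    have := intervalIntegral.integral_comp_sub_left (a := 0) (b := t)
      (fun x => x ^ (ρ - 1) * Real.exp (K * (t - x))) t
    simp only [sub_sub_cancel, sub_self, sub_zero] at this
    rw [this, ← intervalIntegral.integral_const_mul]
    congr 1; ext x
    have : K * (t - x) = K * t + -(K * x) := by ring
    rw [this, Real.exp_add]; ring
  rw [e, mul_comm]
  refine mul_le_mul_of_nonneg_right ?_ (Real.exp_pos _).le
  have hI := Real.integral_rpow_mul_exp_neg_mul_Ioi h0 hK2
  have hInt : IntegrableOn (fun x : ℝ => x ^ (ρ - 1) * Real.exp (-(K * x))) (Ioi 0) := by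
    by_contra hc
    have h2 := integral_undef hc
    rw [hI] at h2
    have : 0 < (1 / K) ^ ρ * Real.Gamma ρ := by positivity
    linarith
  rw [intervalIntegral.integral_of_le ht]
  calc _ ≤ ∫ x in Ioi (0:ℝ), x ^ (ρ - 1) * Real.exp (-(K * x)) := by
        refine setIntegral_mono_set hInt ?_ (Ioc_subset_Ioi_self.eventuallyLE)
        filter_upwards [ae_restrict_mem measurableSet_Ioi] with x hx
        have : (0:ℝ) < x := hx
        positivity
    _ = _ := hI
    _ ≤ ε := hK1.le


section
variable {E : Type*} [NormedAddCommGroup E] [NormedSpace ℝ E]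

lemma ii_hist {a : ℝ} {f : ℝ → E} {τ s : ℝ} (h0 : 0 ≤ τ) (hs : τ < s)
    (hf : IntervalIntegrable f volume 0 τ) :
    IntervalIntegrable (fun ξ => ((s - ξ) ^ a) • f ξ) volume 0 τ := by
  refine hf.continuousOn_smul ?_
  rw [uIcc_of_le h0]
  refine ContinuousOn.rpow_const (by fun_prop) ?_
  intro x hx; left; have := hx.2; intro h0; linarith

lemma ii_near {a : ℝ} (ha : -1 < a) {f : ℝ → E} {τ s : ℝ} (hs : τ ≤ s)
    (hc : ContinuousOn f (Icc τ s)) :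
    IntervalIntegrable (fun ξ => ((s - ξ) ^ a) • f ξ) volume τ s := by
  refine (ii_rpow_right ha τ s).smul_continuousOn ?_
  rwa [uIcc_of_le hs]

lemma FI_ii {a : ℝ} (ha : -1 < a) {f : ℝ → E} {s : ℝ} (hs : 0 < s)
    (hf : IntervalIntegrable f volume 0 s) (hc : ContinuousOn f (Ioc 0 s)) :
    IntervalIntegrable (fun ξ => ((s - ξ) ^ a) • f ξ) volume 0 s := by
  refine IntervalIntegrable.trans (b := s / 2) ?_ ?_
  · refine ii_hist (by linarith) (by linarith) (hf.mono_set ?_)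
    rw [uIcc_of_le (by linarith), uIcc_of_le (by linarith)]
    exact Icc_subset_Icc le_rfl (by linarith)
  · refine ii_near ha (by linarith) (hc.mono ?_)
    intro x hx; exact ⟨by linarith [hx.1], hx.2⟩

lemma FI_split {ρ : ℝ} (h1 : ρ < 1) {f : ℝ → E} {τ s : ℝ} (h0 : 0 < τ) (hs : τ < s)
    (hf : IntervalIntegrable f volume 0 s) (hc : ContinuousOn f (Ioc 0 s)) :
    FI ρ f s = (∫ ξ in (0:ℝ)..τ, ((s - ξ) ^ (-ρ)) • f ξ) + ∫ ξ in τ..s, ((s - ξ) ^ (-ρ)) • f ξ := by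
  rw [FI, intervalIntegral.integral_add_adjacent_intervals]
  · refine ii_hist h0.le hs (hf.mono_set ?_)
    rw [uIcc_of_le h0.le, uIcc_of_le (by linarith)]
    exact Icc_subset_Icc le_rfl hs.le
  · refine ii_near (by linarith) hs.le (hc.mono ?_)
    intro x hx; exact ⟨by linarith [hx.1], hx.2⟩

lemma hist_deriv [CompleteSpace E] {a : ℝ} {f : ℝ → E} {τ s : ℝ} (h0 : 0 ≤ τ) (hs : τ < s)
    (hf : IntervalIntegrable f volume 0 τ) :
    HasDerivAt (fun s => ∫ ξ in (0:ℝ)..τ, ((s - ξ) ^ a) • f ξ)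
      (∫ ξ in (0:ℝ)..τ, (a * (s - ξ) ^ (a - 1)) • f ξ) s := by
  set m := (τ + s) / 2 with hm
  have hm1 : τ < m := by rw [hm]; linarith
  have hm2 : m < s := by rw [hm]; linarith
  -- bound of kernel derivative on [m - τ, s+1]
  obtain ⟨C, hC⟩ : ∃ C, ∀ x ∈ Icc (m - τ) (s + 1), ‖a * x ^ (a - 1)‖ ≤ C := by
    refine isCompact_Icc.exists_bound_of_continuousOn ?_
    refine continuousOn_const.mul (ContinuousOn.rpow_const continuousOn_id ?_)
    intro x hx; left; have := hx.1; intro h; have h' : x = 0 := h; linarith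
  have hmem : Ioo m (s + 1) ∈ 𝓝 s := Ioo_mem_nhds hm2 (by linarith)
  refine (intervalIntegral.hasDerivAt_integral_of_dominated_loc_of_deriv_le
    (F := fun s ξ => ((s - ξ) ^ a) • f ξ) (F' := fun s ξ => (a * (s - ξ) ^ (a - 1)) • f ξ)
    (bound := fun ξ => C * ‖f ξ‖) hmem ?_ ?_ ?_ ?_ ?_ ?_).2
  · filter_upwards [hmem] with x hx
    have := (ii_hist (a := a) h0 (by linarith [hx.1] : τ < x) hf)
    exact this.aestronglyMeasurable_restrict_uIoc
  · exact ii_hist h0 hs hf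
  · have := (ii_hist (a := a - 1) h0 hs hf).smul a
    simp only [mul_smul]
    exact this.aestronglyMeasurable_restrict_uIoc
  · refine Eventually.of_forall fun ξ hξ x hx => ?_
    rw [uIoc_of_le h0] at hξ
    rw [norm_smul]
    refine mul_le_mul_of_nonneg_right (hC _ ⟨?_, ?_⟩) (norm_nonneg _)
    · linarith [hξ.2, hx.1]
    · linarith [hξ.1, hx.2]
  · exact hf.norm.const_mul C
  · refine Eventually.of_forall fun ξ hξ x hx => ?_
    rw [uIoc_of_le h0] at hξ
    refine HasDerivAt.smul_const ?_ _
    have : x - ξ ≠ 0 := by have := hξ.2; have := hx.1; intro h; linarith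
    have h2 := ((hasDerivAt_id x).sub_const ξ).rpow_const (p := a) (Or.inl this)
    simpa using h2

lemma near_cont {a : ℝ} (ha : -1 < a) {f : ℝ → E} {τ b : ℝ}
    (hc : ContinuousOn f (Icc τ b)) {s : ℝ} (hs : s ∈ Ioo τ b) :
    ContinuousAt (fun s => ∫ ξ in τ..s, ((s - ξ) ^ a) • f ξ) s := by
  obtain ⟨M, hM⟩ := isCompact_Icc.exists_bound_of_continuousOn hc
  have hmem : Ioo τ b ∈ 𝓝 s := Ioo_mem_nhds hs.1 hs.2
  have hmap : ∀ y ∈ Ioo τ b, ∀ x ∈ Icc (0:ℝ) 1, (y - τ) * x + τ ∈ Icc τ b := by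
    intro y hy x hx
    have h1 : 0 ≤ (y - τ) * x := mul_nonneg (by linarith [hy.1]) hx.1
    have h2 : (y - τ) * x ≤ (y - τ) * 1 := mul_le_mul_of_nonneg_left hx.2 (by linarith [hy.1])
    constructor <;> linarith [hy.2]
  have key : ContinuousAt (fun y => (y - τ) ^ (a + 1) •
      ∫ x in (0:ℝ)..1, ((1 - x) ^ a) • f ((y - τ) * x + τ)) s := by
    refine ContinuousAt.smul ?_ ?_
    · refine ContinuousAt.rpow_const (by fun_prop) (Or.inl ?_)
      have := hs.1; intro h; linarith
    · refine intervalIntegral.continuousAt_of_dominated_interval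
        (bound := fun x => (1 - x) ^ a * M) ?_ ?_ ?_ ?_
      · filter_upwards [hmem] with y hy
        have : IntervalIntegrable (fun x => ((1 - x) ^ a) • f ((y - τ) * x + τ)) volume 0 1 := by
          refine ii_near ha zero_le_one (hc.comp (by fun_prop) (hmap y hy))
        exact this.aestronglyMeasurable_restrict_uIoc
      · filter_upwards [hmem] with y hy
        refine Eventually.of_forall fun x hx => ?_
        rw [uIoc_of_le zero_le_one] at hx
        rw [norm_smul, Real.norm_eq_abs, abs_of_nonneg (Real.rpow_nonneg (by linarith [hx.2]) _)]
        exact mul_le_mul_of_nonneg_left (hM _ (hmap y hy x ⟨hx.1.le, hx.2⟩))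
          (Real.rpow_nonneg (by linarith [hx.2]) _)
      · exact (ii_rpow_right ha 0 1).mul_const M
      · refine Eventually.of_forall fun x hx => ?_
        rw [uIoc_of_le zero_le_one] at hx
        refine ContinuousAt.smul continuousAt_const ?_
        refine ContinuousAt.comp (g := f) ?_ (by fun_prop)
        refine hc.continuousAt (Icc_mem_nhds ?_ ?_)
        · have : 0 < (s - τ) * x := mul_pos (by linarith [hs.1]) hx.1
          linarith
        · have := mul_le_mul_of_nonneg_left hx.2 (by linarith [hs.1] : 0 ≤ s - τ)
          linarith [hs.2]
  refine key.congr ?_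
  filter_upwards [hmem] with y hy
  have hd : 0 < y - τ := by linarith [hy.1]
  have := intervalIntegral.smul_integral_comp_mul_add (a := 0) (b := 1)
    (fun ξ => ((y - ξ) ^ a) • f ξ) (y - τ) τ
  simp only [mul_zero, zero_add, mul_one, sub_add_cancel] at this
  rw [← this, Real.rpow_add_one hd.ne', mul_comm, mul_smul]
  congr 1
  rw [← intervalIntegral.integral_smul]
  refine intervalIntegral.integral_congr fun x hx => ?_
  rw [uIcc_of_le zero_le_one] at hx
  have e1 : y - ((y - τ) * x + τ) = (y - τ) * (1 - x) := by ring
  rw [e1, Real.mul_rpow hd.le (by linarith [hx.2]), mul_smul]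

lemma FI_cont [CompleteSpace E] {ρ : ℝ} (h1 : ρ < 1) {f : ℝ → E} {T : ℝ}
    (hf : IntervalIntegrable f volume 0 T) (hc : ContinuousOn f (Ioo 0 T)) :
    ContinuousOn (FI ρ f) (Ioo 0 T) := by
  intro s hs
  refine ContinuousAt.continuousWithinAt ?_
  have h0 := hs.1
  have hsT := hs.2
  have hsub : ∀ y, 0 ≤ y → y ≤ T → IntervalIntegrable f volume 0 y := by
    intro y hy hy2
    refine hf.mono_set ?_
    rw [uIcc_of_le hy, uIcc_of_le (by linarith)]
    exact Icc_subset_Icc le_rfl hy2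
  have A := (hist_deriv (a := -ρ) (by linarith : 0 ≤ s / 2) (by linarith : s / 2 < s)
    (hsub (s/2) (by linarith) (by linarith))).continuousAt
  have B := near_cont (a := -ρ) (by linarith) (τ := s / 2) (b := (s + T) / 2)
    (hc.mono (fun x hx => ⟨by linarith [hx.1], by linarith [hx.2]⟩)) (s := s)
    ⟨by linarith, by linarith⟩
  refine (A.add B).congr ?_
  filter_upwards [Ioo_mem_nhds (by linarith : s / 2 < s) hsT] with y hy
  exact (FI_split h1 (by linarith) hy.1 (hsub y (by linarith [hy.1]) hy.2.le)
    (hc.mono fun x hx => ⟨hx.1, by linarith [hx.2, hy.2]⟩)).symm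

end


lemma ii_sub {E : Type*} [NormedAddCommGroup E] {f : ℝ → E} {T : ℝ}
    (hf : IntervalIntegrable f volume 0 T) {x y : ℝ} (hx : 0 ≤ x) (hxy : x ≤ y) (hy : y ≤ T) :
    IntervalIntegrable f volume x y := by
  refine hf.mono_set ?_
  rw [uIcc_of_le hxy, uIcc_of_le (by linarith)]
  exact Icc_subset_Icc hx hy

lemma uniq {ρ lam b c : ℝ} (h0 : 0 < ρ) (h1 : ρ < 1) {y : ℝ → ℝ} (hc0 : 0 ≤ c)
    (hy : IntervalIntegrable y volume 0 b) (hc : ContinuousOn y (Ioo c b))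
    (he : ∀ s ∈ Ioo 0 b, FI ρ y s = -lam * ∫ ξ in (0:ℝ)..s, y ξ) :
    ∀ s ∈ Ioo c b, y s = 0 := by
  set Y : ℝ → ℝ := fun s => ∫ ξ in (0:ℝ)..s, y ξ with hY
  have hB := Bt_pos h0 h1
  have hYc : ∀ b' ∈ Ioo 0 b, ContinuousOn Y (Icc 0 b') := by
    intro b' hb'
    have := intervalIntegral.continuousOn_primitive_interval (f := y) (μ := volume) (a := 0) (b := b')
      ((intervalIntegrable_iff_integrableOn_Icc_of_le hb'.1.le).1 (ii_sub hy le_rfl hb'.1.le hb'.2.le) |> fun h => by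
        rwa [uIcc_of_le hb'.1.le])
    rwa [uIcc_of_le hb'.1.le] at this
  have hV : ∀ t ∈ Ioo 0 b, Bt ρ * Y t = ∫ s in (0:ℝ)..t, (t - s) ^ (ρ - 1) * (-lam * Y s) := by
    intro t ht
    rw [hY, ← (abel h0 h1 ht.1 (ii_sub hy le_rfl ht.1.le ht.2.le)).2]
    refine intervalIntegral.integral_congr_ae (Eventually.of_forall fun s hs => ?_)
    rw [uIoc_of_le ht.1.le] at hs
    rw [he s ⟨hs.1, by linarith [hs.2, ht.2]⟩]
  obtain ⟨K, hK, hest⟩ := exp_est h0 (ε := Bt ρ / (2 * (|lam| + 1))) (by positivity)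
  have hY0 : ∀ b' ∈ Ioo 0 b, Y b' = 0 := by
    intro b' hb'
    have hcont : ContinuousOn (fun s => Real.exp (-(K * s)) * |Y s|) (Icc 0 b') :=
      ContinuousOn.mul (by fun_prop) (hYc b' hb').abs
    obtain ⟨t, htm, htmax⟩ := isCompact_Icc.exists_isMaxOn ⟨0, le_rfl, hb'.1.le⟩ hcont
    set m := Real.exp (-(K * t)) * |Y t| with hm
    have hm0 : 0 ≤ m := by positivity
    have hYm : ∀ s ∈ Icc 0 b', |Y s| ≤ m * Real.exp (K * s) := by
      intro s hs
      have h2 : Real.exp (-(K * s)) * |Y s| ≤ m := htmax hs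
      have h3 := mul_le_mul_of_nonneg_right h2 (Real.exp_pos (K * s)).le
      have h4 : Real.exp (-(K * s)) * |Y s| * Real.exp (K * s) = |Y s| := by
        rw [mul_comm, ← mul_assoc, ← Real.exp_add]; simp
      linarith
    have hmz : m = 0 := by
      rcases eq_or_lt_of_le htm.1 with h | h
      · rw [hm, ← h]; simp [hY]
      have htI : t ∈ Ioo 0 b := ⟨h, by linarith [htm.2, hb'.2]⟩
      have hi : IntervalIntegrable (fun s => (t - s) ^ (ρ - 1) * Real.exp (K * s)) volume 0 t :=
        (ii_rpow_right (by linarith) 0 t).mul_continuousOn (by fun_prop)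
      have e1 : |Bt ρ * Y t| ≤ |lam| * m * ∫ s in (0:ℝ)..t, (t - s) ^ (ρ - 1) * Real.exp (K * s) := by
        rw [hV t htI, ← intervalIntegral.integral_const_mul, ← Real.norm_eq_abs]
        refine intervalIntegral.norm_integral_le_of_norm_le h.le ?_ (hi.const_mul _)
        refine Eventually.of_forall fun s hs => ?_
        have hp : 0 ≤ (t - s) ^ (ρ - 1) := Real.rpow_nonneg (by linarith [hs.2]) _
        rw [Real.norm_eq_abs, abs_mul, abs_mul, abs_neg, abs_of_nonneg hp]
        have := hYm s ⟨hs.1.le, by linarith [hs.2, htm.2]⟩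
        calc _ ≤ (t - s) ^ (ρ - 1) * (|lam| * (m * Real.exp (K * s))) := by gcongr
          _ = _ := by ring
      have e2 := hest t h.le
      have e3 : |Bt ρ * Y t| = Bt ρ * (m * Real.exp (K * t)) := by
        rw [abs_mul, abs_of_pos hB, hm]
        congr 1
        rw [mul_comm, ← mul_assoc, ← Real.exp_add]; simp
      have e4 : Bt ρ * (m * Real.exp (K * t)) ≤ |lam| * m * (Bt ρ / (2 * (|lam| + 1)) * Real.exp (K * t)) := by
        rw [← e3]; refine e1.trans ?_
        gcongr
      have e5 : |lam| / (2 * (|lam| + 1)) ≤ 1 / 2 := by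
        rw [div_le_div_iff₀ (by positivity) (by positivity)]
        linarith [abs_nonneg lam]
      have e6 : |lam| * m * (Bt ρ / (2 * (|lam| + 1)) * Real.exp (K * t)) =
        |lam| / (2 * (|lam| + 1)) * (Bt ρ * (m * Real.exp (K * t))) := by ring
      have e7 : 0 ≤ Bt ρ * (m * Real.exp (K * t)) := by positivity
      have e8 : Bt ρ * (m * Real.exp (K * t)) ≤ 0 := by
        rw [e6] at e4
        have := mul_le_mul_of_nonneg_right e5 e7
        linarith
      by_contra hne
      have : 0 < m := lt_of_le_of_ne hm0 (Ne.symm hne)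
      have : 0 < Bt ρ * (m * Real.exp (K * t)) := by positivity
      linarith
    have := hYm b' ⟨hb'.1.le, le_rfl⟩
    rw [hmz, zero_mul] at this
    exact abs_nonpos_iff.1 this
  intro s hs
  have hs0 : 0 < s := by linarith [hs.1]
  have hd : HasDerivAt Y (y s) s := by
    refine intervalIntegral.integral_hasDerivAt_right (ii_sub hy le_rfl hs0.le hs.2.le) ?_ ?_
    · exact hc.stronglyMeasurableAtFilter isOpen_Ioo s hs
    · exact hc.continuousAt (Ioo_mem_nhds hs.1 hs.2)
  have hd2 : HasDerivAt Y 0 s := by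
    refine (hasDerivAt_const s (0:ℝ)).congr_of_eventuallyEq ?_
    filter_upwards [Ioo_mem_nhds hs0 hs.2] with x hx using hY0 x hx
  exact hd.unique hd2

lemma int_pow_right {ρ : ℝ} (h1 : ρ < 1) (a s : ℝ) :
    ∫ ξ in a..s, (s - ξ) ^ (-ρ) = (s - a) ^ (1 - ρ) / (1 - ρ) := by
  have := intervalIntegral.integral_comp_sub_left (a := a) (b := s) (fun x : ℝ => x ^ (-ρ)) s
  rw [this, integral_rpow (Or.inl (by linarith))]
  rw [sub_self, Real.zero_rpow (by linarith)]
  ring_nf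

lemma pow_incr {ρ : ℝ} (h0 : 0 < ρ) (h1 : ρ < 1) {b s1 s2 : ℝ} (hs1 : 0 < s1) (h : s1 ≤ s2)
    (hb : s2 ≤ b) : b ^ (-ρ) * (s2 - s1) ≤ s2 ^ (1 - ρ) / (1 - ρ) - s1 ^ (1 - ρ) / (1 - ρ) := by
  have e : ∫ x in s1..s2, x ^ (-ρ) = s2 ^ (1 - ρ) / (1 - ρ) - s1 ^ (1 - ρ) / (1 - ρ) := by
    rw [integral_rpow (Or.inl (by linarith))]; ring_nf
  rw [← e]
  have : ∫ x in s1..s2, b ^ (-ρ) = b ^ (-ρ) * (s2 - s1) := by simp [mul_comm]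
  rw [← this]
  refine intervalIntegral.integral_mono_on h (by simp) (intervalIntegral.intervalIntegrable_rpow' (by linarith)) ?_
  intro x hx
  exact Real.rpow_le_rpow_of_nonpos (by linarith [hx.1]) (by linarith [hx.2]) (by linarith)

lemma mp {ρ b τ : ℝ} (h0 : 0 < ρ) (h1 : ρ < 1) (hτ : 0 < τ) (hb : τ < b) {z : ℝ → ℝ}
    (hz : IntervalIntegrable z volume 0 b) (hc : ContinuousOn z (Ioc 0 b))
    (hle : ∀ x ∈ Ioc 0 b, z x ≤ z b) (hpos : 0 < z b)
    (hanti : ∀ s1 s2, τ < s1 → s1 ≤ s2 → s2 ≤ b → FI ρ z s2 ≤ FI ρ z s1) : False := by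
  have hB := Bt_pos h0 h1
  have hb0 : 0 < b := by linarith
  set M := z b with hM
  set v0 : ℝ → ℝ := fun x => M - z x with hv0
  set v : ℝ → ℝ := indicator (Ioi τ) v0 with hv
  have hv0i : IntervalIntegrable v0 volume 0 b := (intervalIntegrable_const).sub hz
  have hv0c : ContinuousOn v0 (Ioc 0 b) := continuousOn_const.sub hc
  have hv0n : ∀ x ∈ Ioc 0 b, 0 ≤ v0 x := fun x hx => sub_nonneg.2 (hle x hx)
  have hvi : IntervalIntegrable v volume 0 b := by
    rw [intervalIntegrable_iff_integrableOn_Ioc_of_le hb0.le] at hv0i ⊢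
    exact hv0i.indicator measurableSet_Ioi
  have hvn : ∀ x ∈ Ioc 0 b, 0 ≤ v x := by
    intro x hx; simp only [hv, indicator]; split_ifs
    · exact hv0n x hx
    · exact le_rfl
  -- values of j = FI v
  have hj : ∀ s, τ < s → s ≤ b → FI ρ v s = M * (s ^ (1 - ρ) / (1 - ρ)) - FI ρ z s
      - ∫ ξ in (0:ℝ)..τ, (s - ξ) ^ (-ρ) * v0 ξ := by
    intro s hs hsb
    have a1 : FI ρ v s = ∫ ξ in τ..s, (s - ξ) ^ (-ρ) * v0 ξ := by
      have : ∀ ξ, (s - ξ) ^ (-ρ) • v ξ = indicator (Ioi τ) (fun ξ => (s - ξ) ^ (-ρ) * v0 ξ) ξ := by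
        intro ξ; simp only [hv, indicator]; split_ifs <;> simp
      rw [FI]; simp_rw [this]
      rw [intervalIntegral.integral_of_le (by linarith), intervalIntegral.integral_of_le hs.le,
        integral_indicator measurableSet_Ioi, Measure.restrict_restrict measurableSet_Ioi]
      congr 2
      ext x; simp only [mem_inter_iff, mem_Ioi, mem_Ioc]
      constructor
      · rintro ⟨p, q, r⟩; exact ⟨p, r⟩
      · rintro ⟨p, q⟩; exact ⟨p, by linarith, q⟩
    have a2 := FI_split h1 hτ hs (ii_sub hv0i le_rfl (by linarith) hsb)
      (hv0c.mono (Ioc_subset_Ioc_right hsb))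
    have a3 : FI ρ v0 s = M * (s ^ (1 - ρ) / (1 - ρ)) - FI ρ z s := by
      have := int_pow_right h1 0 s
      rw [sub_zero] at this
      rw [← this, FI, FI, ← intervalIntegral.integral_const_mul, ← intervalIntegral.integral_sub]
      · congr 1; ext ξ; simp only [hv0, smul_eq_mul]; ring
      · exact (ii_rpow_right (by linarith) 0 s).const_mul M
      · exact FI_ii (by linarith) (by linarith) (ii_sub hz le_rfl (by linarith) hsb)
          (hc.mono (Ioc_subset_Ioc_right hsb))
    simp only [smul_eq_mul] at a2
    rw [a1, ← a3, a2]; ring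
  set κ := M * b ^ (-ρ) with hκ
  have hκp : 0 < κ := by positivity
  have hinc : ∀ s1 s2, τ < s1 → s1 ≤ s2 → s2 ≤ b → κ * (s2 - s1) ≤ FI ρ v s2 - FI ρ v s1 := by
    intro s1 s2 hs1 hs hs2
    rw [hj s2 (by linarith) hs2, hj s1 hs1 (by linarith)]
    have a1 := hanti s1 s2 hs1 hs hs2
    have a2 := pow_incr h0 h1 (by linarith : 0 < s1) hs hs2
    have a3 : ∫ ξ in (0:ℝ)..τ, (s2 - ξ) ^ (-ρ) * v0 ξ ≤ ∫ ξ in (0:ℝ)..τ, (s1 - ξ) ^ (-ρ) * v0 ξ := by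
      have hi := ii_sub hv0i le_rfl hτ.le hb.le
      refine intervalIntegral.integral_mono_on_of_le_Ioo hτ.le (ii_hist hτ.le (by linarith) hi) (ii_hist hτ.le hs1 hi) ?_
      intro x hx
      refine mul_le_mul_of_nonneg_right ?_ (hv0n x ⟨hx.1, by linarith [hx.2]⟩)
      exact Real.rpow_le_rpow_of_nonpos (by linarith [hx.2]) (by linarith) (by linarith)
    have a4 := mul_le_mul_of_nonneg_left a2 hpos.le
    have a5 : κ * (s2 - s1) = M * (b ^ (-ρ) * (s2 - s1)) := by rw [hκ]; ring
    rw [a5]; linarith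
  have hjn : ∀ s, 0 ≤ s → s ≤ b → 0 ≤ FI ρ v s := by
    intro s hs hsb
    refine intervalIntegral.integral_nonneg_of_ae_restrict hs ?_
    rw [← restrict_Ioc_eq_restrict_Icc]
    filter_upwards [ae_restrict_mem measurableSet_Ioc] with ξ hξ
    exact mul_nonneg (Real.rpow_nonneg (by linarith [hξ.2]) _) (hvn ξ ⟨hξ.1, by linarith [hξ.2]⟩)
  have hjz : ∀ s, 0 ≤ s → s ≤ τ → FI ρ v s = 0 := by
    intro s hs hsb
    rw [FI]
    rw [intervalIntegral.integral_congr_ae (g := fun _ => (0:ℝ))]; · simp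
    refine Eventually.of_forall fun ξ hξ => ?_
    rw [uIoc_of_le hs] at hξ
    have : v ξ = 0 := by
      rw [hv]; refine indicator_of_notMem ?_ _
      simp only [mem_Ioi, not_lt]; linarith [hξ.2]
    rw [this, smul_zero]
  have hmono : ∀ s1 s2, 0 ≤ s1 → s1 ≤ s2 → s2 ≤ b → FI ρ v s1 ≤ FI ρ v s2 := by
    intro s1 s2 hs1 hs hs2
    rcases le_or_gt s1 τ with h | h
    · rw [hjz s1 hs1 h]; exact hjn s2 (by linarith) hs2
    · have := hinc s1 s2 h hs hs2
      have : 0 ≤ κ * (s2 - s1) := mul_nonneg hκp.le (by linarith)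
      linarith
  set δ := (b - τ) / 2 with hδ
  have hδp : 0 < δ := by rw [hδ]; linarith
  have main : ∀ ε, 0 < ε → ε < δ → κ * ε * (δ ^ ρ / ρ) ≤ Bt ρ * ∫ s in (b - ε)..b, v s := by
    intro ε hε hεδ
    have hbε : 0 < b - ε := by linarith
    obtain ⟨i1, e1⟩ := abel h0 h1 hb0 hvi
    obtain ⟨i2, e2⟩ := abel h0 h1 hbε (ii_sub hvi le_rfl hbε.le (by linarith))
    have i3 : IntervalIntegrable (fun s => (b - s) ^ (ρ - 1) * FI ρ v (s - ε)) volume ε b := by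
      have := i2.comp_sub_right ε
      simp only [zero_add, sub_add_cancel] at this
      refine this.congr (fun s _ => ?_)
      have e : b - ε - (s - ε) = b - s := by ring
      simp only [e]
    have e3 : ∫ s in (0:ℝ)..(b - ε), (b - ε - s) ^ (ρ - 1) * FI ρ v s
        = ∫ s in ε..b, (b - s) ^ (ρ - 1) * FI ρ v (s - ε) := by
      have := intervalIntegral.integral_comp_sub_right (a := ε) (b := b)
        (fun s => (b - ε - s) ^ (ρ - 1) * FI ρ v s) ε
      rw [sub_self] at this
      rw [← this]
      congr 1; ext s; congr 2; ring
    have i1a : IntervalIntegrable (fun s => (b - s) ^ (ρ - 1) * FI ρ v s) volume 0 ε :=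
      ii_sub i1 le_rfl hε.le (by linarith)
    have i1b : IntervalIntegrable (fun s => (b - s) ^ (ρ - 1) * FI ρ v s) volume ε b :=
      ii_sub i1 hε.le (by linarith) le_rfl
    have e4 := intervalIntegral.integral_add_adjacent_intervals i1a i1b
    have p1 : 0 ≤ ∫ s in (0:ℝ)..ε, (b - s) ^ (ρ - 1) * FI ρ v s := by
      refine intervalIntegral.integral_nonneg hε.le fun s hs => ?_
      exact mul_nonneg (Real.rpow_nonneg (by linarith [hs.2]) _) (hjn s hs.1 (by linarith [hs.2]))
    have e5 : ∫ s in ε..b, ((b - s) ^ (ρ - 1) * FI ρ v s - (b - s) ^ (ρ - 1) * FI ρ v (s - ε))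
      = (∫ s in ε..b, (b - s) ^ (ρ - 1) * FI ρ v s) - ∫ s in ε..b, (b - s) ^ (ρ - 1) * FI ρ v (s - ε) :=
      intervalIntegral.integral_sub i1b i3
    have i5 := i1b.sub i3
    have hmem : b - δ ∈ uIcc ε b := by
      rw [uIcc_of_le (by linarith)]; constructor <;> linarith
    have i5a : IntervalIntegrable (fun s => (b - s) ^ (ρ - 1) * FI ρ v s - (b - s) ^ (ρ - 1) * FI ρ v (s - ε)) volume ε (b - δ) :=
      i5.mono_set (uIcc_subset_uIcc left_mem_uIcc hmem)
    have i5b : IntervalIntegrable (fun s => (b - s) ^ (ρ - 1) * FI ρ v s - (b - s) ^ (ρ - 1) * FI ρ v (s - ε)) volume (b - δ) b :=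
      i5.mono_set (uIcc_subset_uIcc hmem right_mem_uIcc)
    have e6 := intervalIntegral.integral_add_adjacent_intervals i5a i5b
    have p2 : 0 ≤ ∫ s in ε..(b - δ), ((b - s) ^ (ρ - 1) * FI ρ v s - (b - s) ^ (ρ - 1) * FI ρ v (s - ε)) := by
      refine intervalIntegral.integral_nonneg (by linarith) fun s hs => ?_
      rw [← mul_sub]
      refine mul_nonneg (Real.rpow_nonneg (by linarith [hs.2]) _) ?_
      have := hmono (s - ε) s (by linarith [hs.1]) (by linarith) (by linarith [hs.2])
      linarith
    have p3 : κ * ε * (δ ^ ρ / ρ) ≤ ∫ s in (b - δ)..b, ((b - s) ^ (ρ - 1) * FI ρ v s - (b - s) ^ (ρ - 1) * FI ρ v (s - ε)) := by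
      have := int_pow_right (ρ := 1 - ρ) (by linarith) (b - δ) b
      rw [sub_sub_cancel, sub_sub_cancel, neg_sub] at this
      rw [← this, ← intervalIntegral.integral_const_mul]
      refine intervalIntegral.integral_mono_on (by linarith) ((ii_rpow_right (by linarith) _ _).const_mul _) i5b ?_
      intro s hs
      rw [← mul_sub, mul_comm]
      refine mul_le_mul_of_nonneg_left ?_ (Real.rpow_nonneg (by linarith [hs.2]) _)
      have := hinc (s - ε) s (by linarith [hs.1]) (by linarith) hs.2
      rwa [sub_sub_cancel] at this
    have e7 := intervalIntegral.integral_add_adjacent_intervals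
      (ii_sub hvi le_rfl hbε.le (by linarith)) (ii_sub hvi hbε.le (by linarith) le_rfl : IntervalIntegrable v volume (b - ε) b)
    have e8 : Bt ρ * ∫ s in (b - ε)..b, v s = Bt ρ * (∫ s in (0:ℝ)..b, v s) - Bt ρ * ∫ s in (0:ℝ)..(b - ε), v s := by
      rw [← e7]; ring
    rw [e8, ← e1, ← e2, e3]
    linarith
  -- v small near b
  set η := κ * (δ ^ ρ / ρ) / (2 * Bt ρ) with hη
  have hηp : 0 < η := by positivity
  have hcb : ContinuousWithinAt v0 (Ioc 0 b) b := hv0c b ⟨hb0, le_rfl⟩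
  have hv0b : v0 b = 0 := by simp [hv0, hM]
  have hev : ∀ᶠ x in 𝓝[Ioc 0 b] b, v0 x < η := by
    refine hcb.eventually (gt_mem_nhds ?_)
    rw [hv0b]; exact hηp
  rw [nhdsWithin_Ioc_eq_nhdsLE hb0] at hev
  obtain ⟨l, hl, hl2⟩ := (mem_nhdsLE_iff_exists_Ioc_subset).1 hev
  have hl' : l < b := hl
  set ε := min (δ / 2) ((b - l) / 2) with hε
  have hεp : 0 < ε := by rw [hε]; exact lt_min (by linarith) (by linarith)
  have hε1 : ε < δ := (min_le_left _ _).trans_lt (by linarith)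
  have hε2 : ε < b - l := (min_le_right _ _).trans_lt (by linarith)
  have hfin := main ε hεp hε1
  have hup : ∫ s in (b - ε)..b, v s ≤ ∫ s in (b - ε)..b, η := by
    refine intervalIntegral.integral_mono_on (by linarith) (ii_sub hvi (by linarith) (by linarith) le_rfl) (by simp) ?_
    intro x hx
    have h2 : v0 x < η := hl2 ⟨by linarith [hx.1], hx.2⟩
    simp only [hv, indicator]; split_ifs
    · exact h2.le
    · exact hηp.le
  simp only [intervalIntegral.integral_const, sub_sub_cancel, smul_eq_mul] at hup
  have h5 := mul_le_mul_of_nonneg_left hup hB.le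
  have h6 : Bt ρ * (ε * η) = κ * ε * (δ ^ ρ / ρ) / 2 := by
    rw [hη]; field_simp
  have h7 : 0 < κ * ε * (δ ^ ρ / ρ) := by positivity
  linarith


lemma FI_zero {ρ : ℝ} {y : ℝ → ℝ} {s : ℝ} (hs : 0 ≤ s) (hz : ∀ x ∈ Ioc 0 s, y x = 0) :
    FI ρ y s = 0 := by
  rw [FI, intervalIntegral.integral_congr_ae (g := fun _ => (0:ℝ))]; · simp
  refine Eventually.of_forall fun ξ hξ => ?_
  rw [uIoc_of_le hs] at hξ
  rw [hz ξ hξ, smul_zero]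

lemma int_zero {y : ℝ → ℝ} {s : ℝ} (hs : 0 ≤ s) (hz : ∀ x ∈ Ioc 0 s, y x = 0) :
    ∫ x in (0:ℝ)..s, y x = 0 := by
  rw [intervalIntegral.integral_congr_ae (g := fun _ => (0:ℝ))]; · simp
  refine Eventually.of_forall fun ξ hξ => ?_
  rw [uIoc_of_le hs] at hξ
  rw [hz ξ hξ]

lemma uniq_at {ρ lam b c : ℝ} (h0 : 0 < ρ) (h1 : ρ < 1) {y : ℝ → ℝ} (hc0 : 0 ≤ c) (hcb : c ≤ b)
    (hy : IntervalIntegrable y volume 0 b) (hc : ContinuousOn y (Ioo c b))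
    (hz : ∀ x ∈ Ioc 0 c, y x = 0)
    (he : ∀ s ∈ Ioo c b, FI ρ y s = -lam * ∫ ξ in c..s, y ξ) :
    ∀ s ∈ Ioo c b, y s = 0 := by
  refine uniq (lam := lam) h0 h1 hc0 hy hc ?_
  intro s hs
  rcases le_or_gt s c with h | h
  · have hz' : ∀ x ∈ Ioc 0 s, y x = 0 := fun x hx => hz x ⟨hx.1, hx.2.trans h⟩
    rw [FI_zero hs.1.le hz', int_zero hs.1.le hz']; simp
  · rw [he s ⟨h, hs.2⟩, ← intervalIntegral.integral_add_adjacent_intervals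
      (ii_sub hy le_rfl hc0 hcb) (ii_sub hy hc0 h.le hs.2.le), int_zero hc0 hz, zero_add]

structure Sol (ρ lam T : ℝ) (w : ℝ → ℝ) : Prop where
  ii : IntervalIntegrable w volume 0 T
  cont : ContinuousOn w (Ioo 0 T)
  d : ∀ s ∈ Ioo 0 T, w s ≠ 0 → HasDerivAt (FI ρ w) (-lam * w s) s
  flat : ∀ p q, 0 < p → p < q → q < T → (∀ x ∈ Ioo p q, w x = 0) →
    ∃ p' q', p < p' ∧ p' < q' ∧ q' < q ∧ FI ρ w p' = FI ρ w q'

lemma FI_neg (ρ : ℝ) (w : ℝ → ℝ) : FI ρ (fun x => - w x) = fun s => - FI ρ w s := by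
  ext s; simp [FI]

lemma FI_sub {ρ : ℝ} (h1 : ρ < 1) {w h : ℝ → ℝ} {T s : ℝ} (hs : s ∈ Ioo 0 T)
    (wi : IntervalIntegrable w volume 0 T) (wc : ContinuousOn w (Ioo 0 T))
    (hi : IntervalIntegrable h volume 0 T) (hc : ContinuousOn h (Ioo 0 T)) :
    FI ρ (fun x => w x - h x) s = FI ρ w s - FI ρ h s := by
  rw [FI, FI, FI, ← intervalIntegral.integral_sub]
  · simp only [smul_sub]
  · exact FI_ii (by linarith) hs.1 (ii_sub wi le_rfl hs.1.le hs.2.le)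
      (wc.mono fun x hx => ⟨hx.1, by linarith [hx.2, hs.2]⟩)
  · exact FI_ii (by linarith) hs.1 (ii_sub hi le_rfl hs.1.le hs.2.le)
      (hc.mono fun x hx => ⟨hx.1, by linarith [hx.2, hs.2]⟩)

lemma Sol.neg {ρ lam T : ℝ} {w : ℝ → ℝ} (hw : Sol ρ lam T w) : Sol ρ lam T (fun x => - w x) := by
  refine ⟨hw.ii.neg, hw.cont.neg, ?_, ?_⟩
  · intro s hs hne
    rw [FI_neg]
    have := (hw.d s hs (by simpa using hne)).neg
    exact HasDerivAt.congr_deriv this (by ring)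
  · intro p q hp hpq hq hz
    obtain ⟨p', q', a, b, c, e⟩ := hw.flat p q hp hpq hq (fun x hx => by simpa using hz x hx)
    exact ⟨p', q', a, b, c, by simp [FI_neg, e]⟩

lemma Sol.incr {ρ lam T : ℝ} (h1 : ρ < 1) {w : ℝ → ℝ} (hw : Sol ρ lam T w) {s1 s2 : ℝ}
    (hs1 : 0 < s1) (h : s1 ≤ s2) (hs2 : s2 < T) (hne : ∀ x ∈ Ioo s1 s2, w x ≠ 0) :
    FI ρ w s2 - FI ρ w s1 = -lam * ∫ x in s1..s2, w x := by
  rw [← intervalIntegral.integral_const_mul]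
  symm
  refine intervalIntegral.integral_eq_sub_of_hasDerivAt_of_le h ?_ ?_ ?_
  · exact (FI_cont h1 hw.ii hw.cont).mono fun x hx => ⟨by linarith [hx.1], by linarith [hx.2]⟩
  · intro x hx
    exact hw.d x ⟨by linarith [hx.1], by linarith [hx.2]⟩ (hne x hx)
  · exact (ii_sub hw.ii hs1.le h hs2.le).const_mul _

lemma FI_comp (ρ : ℝ) (z : ℝ → ℝ) (s : ℝ) : FI ρ z s = ∫ x in (0:ℝ)..s, x ^ (-ρ) * z (s - x) := by
  have := intervalIntegral.integral_comp_sub_left (a := 0) (b := s)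
    (fun ξ : ℝ => (s - ξ) ^ (-ρ) • z ξ) s
  simp only [sub_self, sub_zero, sub_sub_cancel, smul_eq_mul] at this
  rw [this, FI]; simp

lemma FI_mono {ρ : ℝ} (h1 : ρ < 1) {z : ℝ → ℝ} {T p q : ℝ} (hp : 0 < p) (hpq : p ≤ q) (hq : q < T)
    (zi : IntervalIntegrable z volume 0 T) (zc : ContinuousOn z (Ioo 0 T))
    (hm : ∀ x y, 0 < x → x ≤ y → y ≤ q → z x ≤ z y) (hn : ∀ x ∈ Ioc 0 q, 0 ≤ z x) :
    FI ρ z p ≤ FI ρ z q := by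
  have ii : ∀ s ∈ Ioo 0 T, IntervalIntegrable (fun x => x ^ (-ρ) * z (s - x)) volume 0 s := by
    intro s hs
    have := (FI_ii (a := -ρ) (by linarith) hs.1 (ii_sub zi le_rfl hs.1.le hs.2.le)
      (zc.mono fun x hx => ⟨hx.1, by linarith [hx.2, hs.2]⟩)).comp_sub_left s
    simp only [sub_self, sub_zero, sub_sub_cancel, smul_eq_mul] at this
    exact this.symm
  have iq := ii q ⟨by linarith, hq⟩
  rw [FI_comp, FI_comp, ← intervalIntegral.integral_add_adjacent_intervals
    (ii_sub iq le_rfl hp.le hpq) (ii_sub iq hp.le hpq le_rfl)]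
  have a1 : ∫ x in (0:ℝ)..p, x ^ (-ρ) * z (p - x) ≤ ∫ x in (0:ℝ)..p, x ^ (-ρ) * z (q - x) := by
    refine intervalIntegral.integral_mono_on_of_le_Ioo hp.le (ii p ⟨hp, by linarith⟩)
      (ii_sub iq le_rfl hp.le hpq) ?_
    intro x hx
    refine mul_le_mul_of_nonneg_left ?_ (Real.rpow_nonneg hx.1.le _)
    exact hm _ _ (by linarith [hx.2]) (by linarith) (by linarith [hx.1])
  have a2 : 0 ≤ ∫ x in p..q, x ^ (-ρ) * z (q - x) := by
    rw [intervalIntegral.integral_of_le hpq, integral_Ioc_eq_integral_Ioo]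
    refine setIntegral_nonneg measurableSet_Ioo fun x hx => ?_
    exact mul_nonneg (Real.rpow_nonneg (by linarith [hx.1]) _)
      (hn _ ⟨by linarith [hx.2], by linarith [hx.1]⟩)
  linarith

lemma step {ρ lam T : ℝ} (h0 : 0 < ρ) (h1 : ρ < 1) (hl : 0 < lam) {w h : ℝ → ℝ}
    (hw : Sol ρ lam T w) (hi : IntervalIntegrable h volume 0 T) (hc : ContinuousOn h (Ioo 0 T))
    {c e : ℝ} (hc0 : 0 < c) (hce : c < e) (heT : e ≤ T) (hwh : ∀ x ∈ Ioc 0 c, w x = h x)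
    (hhc : h c = 0) (hanti : StrictAntiOn h (Ico c e))
    (hJ : ∀ s1 s2, c ≤ s1 → s1 ≤ s2 → s2 < e → FI ρ h s2 - FI ρ h s1 = -lam * ∫ x in s1..s2, h x) :
    ∀ s ∈ Ioo c e, w s = h s := by
  set z : ℝ → ℝ := fun x => w x - h x with hz
  have zi : IntervalIntegrable z volume 0 T := hw.ii.sub hi
  have zc : ContinuousOn z (Ioo 0 T) := hw.cont.sub hc
  have hneg : ∀ x ∈ Ioo c e, h x < 0 := by
    intro x hx
    have := hanti ⟨le_rfl, hce⟩ ⟨hx.1.le, hx.2⟩ hx.1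
    linarith
  have z0 : ∀ x ∈ Ioc 0 c, z x = 0 := fun x hx => sub_eq_zero.2 (hwh x hx)
  have zincr : ∀ s1 s2, c ≤ s1 → s1 ≤ s2 → s2 < e → (∀ x ∈ Ioo s1 s2, w x ≠ 0) →
      FI ρ z s2 - FI ρ z s1 = -lam * ∫ x in s1..s2, z x := by
    intro s1 s2 a b d hne
    rw [FI_sub h1 ⟨by linarith, by linarith⟩ hw.ii hw.cont hi hc,
      FI_sub h1 ⟨by linarith, by linarith⟩ hw.ii hw.cont hi hc, intervalIntegral.integral_sub
      (ii_sub hw.ii (by linarith) b (by linarith)) (ii_sub hi (by linarith) b (by linarith))]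
    have e1 := hw.incr h1 (by linarith) b (by linarith) hne
    have e2 := hJ s1 s2 a b d
    linear_combination e1 - e2
  have hcat : ∀ x ∈ Ioo c e, ContinuousAt w x := fun x hx =>
    hw.cont.continuousAt (Ioo_mem_nhds (by linarith [hx.1]) (by linarith [hx.2]))
  have hzat : ∀ x ∈ Ioo c e, ContinuousAt z x := fun x hx =>
    zc.continuousAt (Ioo_mem_nhds (by linarith [hx.1]) (by linarith [hx.2]))
  have noMP : ∀ b ∈ Ioo c e, 0 < z b → (∀ x ∈ Ioc 0 b, z x ≤ z b) → ∀ τ, c ≤ τ → τ < b →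
      (∀ x ∈ Ioo τ b, w x ≠ 0) → False := by
    intro b hb hzb hmax τ hcτ hτb hne
    have hev : ∀ᶠ x in 𝓝[≤] b, 0 < z x :=
      ((hzat b hb).eventually (lt_mem_nhds hzb)).filter_mono nhdsWithin_le_nhds
    obtain ⟨l, hlb, hl2⟩ := (mem_nhdsLE_iff_exists_Ioc_subset).1 hev
    have hlb' : l < b := hlb
    have hτ' : max τ l < b := max_lt hτb hlb'
    refine mp h0 h1 (lt_of_lt_of_le (by linarith) (le_max_left τ l)) hτ'
      (ii_sub zi le_rfl (by linarith [hb.1]) (by linarith [hb.2]))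
      (zc.mono fun x hx => ⟨hx.1, by linarith [hx.2, hb.2]⟩) hmax hzb ?_
    intro s1 s2 hs1 hs hs2
    have k1 : τ < s1 := (le_max_left τ l).trans_lt hs1
    have k2 : l < s1 := (le_max_right τ l).trans_lt hs1
    have e1 := zincr s1 s2 (by linarith) hs (by linarith [hb.2])
      (fun x hx => hne x ⟨by linarith [hx.1], by linarith [hx.2]⟩)
    have e2 : 0 ≤ ∫ x in s1..s2, z x := by
      refine intervalIntegral.integral_nonneg hs fun x hx => ?_
      exact (hl2 ⟨by linarith [hx.1], by linarith [hx.2]⟩ : 0 < z x).le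
    nlinarith
  have S1 : ∀ t ∈ Ioo c e, w t ≤ 0 := by
    intro t ht
    by_contra hcon
    push Not at hcon
    have hzt : 0 < z t := by have := hneg t ht; simp only [hz]; linarith
    obtain ⟨b, hb, hbmax⟩ := isCompact_Icc.exists_isMaxOn ⟨t, ht.1.le, le_rfl⟩
      (zc.mono (fun x hx => ⟨by linarith [hx.1], by linarith [hx.2, ht.2]⟩ : Icc c t ⊆ Ioo 0 T))
    have hbt : z t ≤ z b := hbmax (show t ∈ Icc c t from ⟨ht.1.le, le_rfl⟩)
    have hcb : c < b := by
      rcases eq_or_lt_of_le hb.1 with h | h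
      · have := z0 c ⟨hc0, le_rfl⟩
        rw [h] at this; linarith
      · exact h
    have hbI : b ∈ Ioo c e := ⟨hcb, by linarith [hb.2, ht.2]⟩
    have hmax : ∀ x ∈ Ioc 0 b, z x ≤ z b := by
      intro x hx
      rcases le_or_gt x c with h | h
      · rw [z0 x ⟨hx.1, h⟩]; linarith
      · exact hbmax (show x ∈ Icc c t from ⟨h.le, hx.2.trans hb.2⟩)
    have hwb : w b = 0 := by
      by_contra hne
      have hev : ∀ᶠ x in 𝓝[≤] b, w x ≠ 0 :=
        ((hcat b hbI).eventually_ne hne).filter_mono nhdsWithin_le_nhds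
      obtain ⟨l, hlb, hl2⟩ := (mem_nhdsLE_iff_exists_Ioc_subset).1 hev
      have hlb' : l < b := hlb
      exact noMP b hbI (by linarith) hmax (max c l) (le_max_left _ _) (max_lt hcb hlb')
        (fun x hx => hl2 ⟨(le_max_right _ _).trans_lt hx.1, hx.2.le⟩)
    have : h t ≤ h b := hanti.antitoneOn ⟨hbI.1.le, hbI.2⟩ ⟨ht.1.le, ht.2⟩ hb.2
    simp only [hz] at hbt
    linarith
  have S2 : ∀ b ∈ Ioo c e, w b = 0 → ∀ τ, c ≤ τ → τ < b → ¬ (∀ x ∈ Ioo τ b, w x ≠ 0) := by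
    intro b hb hwb τ hcτ hτb hne
    have hzb : z b = - h b := by simp [hz, hwb]
    have := hneg b hb
    refine noMP b hb (by linarith) ?_ τ hcτ hτb hne
    intro x hx
    rcases le_or_gt x c with h | h'
    · rw [z0 x ⟨hx.1, h⟩]; linarith
    · have a1 := S1 x ⟨h', by linarith [hx.2, hb.2]⟩
      have a2 : h b ≤ h x := hanti.antitoneOn ⟨h'.le, by linarith [hx.2, hb.2]⟩ ⟨hb.1.le, hb.2⟩ hx.2
      simp only [hz, hwb]; linarith
  have S3 : ∀ x ∈ Ioo c e, w x ≠ 0 := by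
    intro b hb hwb
    have hall : ∀ x ∈ Ioo c b, w x = 0 := by
      intro x0 hx0
      by_contra hne
      have hcl : IsClosed (Icc x0 b ∩ w ⁻¹' {0}) :=
        ContinuousOn.preimage_isClosed_of_isClosed
          (hw.cont.mono fun x hx => ⟨by linarith [hx.1, hx0.1], by linarith [hx.2, hb.2]⟩)
          isClosed_Icc isClosed_singleton
      have hK : IsCompact (Icc x0 b ∩ w ⁻¹' {0}) :=
        isCompact_Icc.of_isClosed_subset hcl inter_subset_left
      obtain ⟨b', hb', hleast⟩ := hK.exists_isLeast ⟨b, ⟨hx0.2.le, le_rfl⟩, hwb⟩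
      have hwb' : w b' = 0 := hb'.2
      have hlt : x0 < b' := by
        rcases eq_or_lt_of_le hb'.1.1 with h | h
        · rw [h] at hne; exact absurd hwb' hne
        · exact h
      refine S2 b' ⟨by linarith [hx0.1], by linarith [hb'.1.2, hb.2]⟩ hwb' x0 hx0.1.le hlt ?_
      intro x hx hx0'
      have : b' ≤ x := hleast ⟨⟨hx.1.le, by linarith [hx.2, hb'.1.2]⟩, hx0'⟩
      linarith [hx.2]
    obtain ⟨p, q, hp, hpq, hq, heq⟩ := hw.flat c b hc0 hb.1 (by linarith [hb.2]) hall
    have e1 := hJ p q hp.le hpq.le (by linarith [hb.2])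
    have e2 : ∫ x in p..q, h x < 0 := by
      have : 0 < ∫ x in p..q, - h x := by
        refine intervalIntegral.intervalIntegral_pos_of_pos_on
          (ii_sub hi (by linarith) hpq.le (by linarith [hb.2])).neg ?_ hpq
        intro x hx
        have := hneg x ⟨by linarith [hx.1], by linarith [hx.2, hb.2]⟩
        linarith
      rw [intervalIntegral.integral_neg] at this; linarith
    have zval : ∀ x, c < x → x ≤ q → z x = - h x := fun x hx hxq => by
      simp [hz, hall x ⟨hx, by linarith⟩]
    have e3 : FI ρ z p ≤ FI ρ z q := by
      refine FI_mono h1 (T := T) (by linarith) hpq.le (by linarith [hb.2]) zi zc ?_ ?_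
      · intro x y hx hxy hy
        rcases le_or_gt x c with h3 | h3
        · rw [z0 x ⟨hx, h3⟩]
          rcases le_or_gt y c with h4 | h4
          · rw [z0 y ⟨by linarith, h4⟩]
          · rw [zval y h4 hy]
            have := hneg y ⟨h4, by linarith [hb.2]⟩
            linarith
        · rw [zval x h3 (by linarith), zval y (by linarith) hy]
          have : h y ≤ h x := hanti.antitoneOn ⟨h3.le, by linarith [hb.2]⟩
            ⟨by linarith, by linarith [hb.2]⟩ hxy
          linarith
      · intro x hx
        rcases le_or_gt x c with h3 | h3
        · rw [z0 x ⟨hx.1, h3⟩]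
        · rw [zval x h3 hx.2]
          have := hneg x ⟨h3, by linarith [hb.2, hx.2]⟩
          linarith
    rw [FI_sub h1 ⟨by linarith, by linarith [hb.2]⟩ hw.ii hw.cont hi hc,
      FI_sub h1 ⟨by linarith, by linarith [hb.2]⟩ hw.ii hw.cont hi hc] at e3
    nlinarith
  have fin := uniq_at (lam := lam) (b := e) h0 h1 hc0.le hce.le (ii_sub zi le_rfl (by linarith) heT)
    (zc.mono fun x hx => ⟨by linarith [hx.1], by linarith [hx.2]⟩) z0 (by
      intro s hs
      have := zincr c s le_rfl hs.1.le hs.2 (fun x hx => S3 x ⟨hx.1, by linarith [hx.2, hs.2]⟩)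
      rwa [FI_zero hc0.le z0, sub_zero] at this)
  intro s hs
  exact sub_eq_zero.1 (fin s hs)


lemma hol_int {U : Set ℂ} {F : ℂ → ℝ → ℂ} {a b : ℝ} (hab : a ≤ b)
    (hd : ∀ x ∈ Ioc a b, DifferentiableOn ℂ (fun z => F z x) U)
    (hm : ∀ z ∈ U, AEStronglyMeasurable (F z) (volume.restrict (Ioc a b)))
    (hb : ∀ z0 ∈ U, ∃ r > 0, Metric.closedBall z0 r ⊆ U ∧ ∃ bd : ℝ → ℝ,
      IntervalIntegrable bd volume a b ∧
      ∀ x ∈ Ioc a b, ∀ z ∈ Metric.closedBall z0 r, ‖F z x‖ ≤ bd x) :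
    DifferentiableOn ℂ (fun z => ∫ x in a..b, F z x) U := by
  intro z0 hz0
  obtain ⟨r, hr, hrU, bd, hbd, hle⟩ := hb z0 hz0
  have hballU : ∀ z ∈ Metric.ball z0 r, U ∈ 𝓝 z := fun z hz =>
    Filter.mem_of_superset (Metric.isOpen_ball.mem_nhds hz) (Metric.ball_subset_closedBall.trans hrU)
  have hz0b : z0 ∈ Metric.ball z0 r := Metric.mem_ball_self hr
  have hder : ∀ x ∈ Ioc a b, ∀ z ∈ Metric.ball z0 r,
      HasDerivAt (fun z => F z x) (deriv (fun z => F z x) z) z := fun x hx z hz =>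
    ((hd x hx).differentiableAt (hballU z hz)).hasDerivAt
  have hr2 : 0 < r / 2 := by linarith
  refine DifferentiableAt.differentiableWithinAt (HasDerivAt.differentiableAt
    (intervalIntegral.hasDerivAt_integral_of_dominated_loc_of_deriv_le
    (F := F) (F' := fun z x => deriv (fun z => F z x) z)
    (bound := fun x => bd x / (r / 2)) (Metric.ball_mem_nhds z0 hr2) ?_ ?_ ?_ ?_ ?_ ?_).2)
  · rw [uIoc_of_le hab]
    filter_upwards [hballU z0 hz0b] with z hz using hm z hz
  · rw [intervalIntegrable_iff, uIoc_of_le hab]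
    rw [intervalIntegrable_iff, uIoc_of_le hab] at hbd
    refine Integrable.mono' hbd (hm z0 hz0) ?_
    filter_upwards [ae_restrict_mem measurableSet_Ioc] with x hx
    exact hle x hx z0 (Metric.mem_closedBall_self hr.le)
  · rw [uIoc_of_le hab]
    have hseq : Tendsto (fun n : ℕ => z0 + ((1 / ((n:ℝ) + 1) : ℝ) : ℂ)) atTop (𝓝 z0) := by
      have h1 := tendsto_one_div_add_atTop_nhds_zero_nat (𝕜 := ℝ)
      have h2 := (Complex.continuous_ofReal.tendsto 0).comp h1
      simpa using h2.const_add z0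
    have hne : ∀ n : ℕ, z0 + ((1 / ((n:ℝ) + 1) : ℝ) : ℂ) ≠ z0 := by
      intro n h
      have h3 : ((1 / ((n:ℝ) + 1) : ℝ) : ℂ) = 0 := by simpa using h
      have h4 : (1 / ((n:ℝ) + 1) : ℝ) = 0 := by exact_mod_cast h3
      have : (0:ℝ) < 1 / ((n:ℝ) + 1) := by positivity
      linarith
    obtain ⟨N, hN⟩ := (hseq.eventually (Metric.ball_mem_nhds z0 hr)).exists_forall_of_atTop
    have hseq' := hseq.comp (tendsto_add_atTop_nat N)
    refine aestronglyMeasurable_of_tendsto_ae atTop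
      (f := fun n : ℕ => fun x => slope (fun z => F z x) z0 (z0 + ((1 / (((n + N : ℕ):ℝ) + 1) : ℝ) : ℂ)))
      (fun n => ?_) ?_
    · have hzn : z0 + ((1 / (((n + N : ℕ):ℝ) + 1) : ℝ) : ℂ) ∈ U :=
        hrU (Metric.ball_subset_closedBall (hN (n + N) (by omega)))
      simp only [slope, vsub_eq_sub]
      exact ((hm _ hzn).sub (hm z0 hz0)).const_smul (_ : ℂ)
    · filter_upwards [ae_restrict_mem measurableSet_Ioc] with x hx
      have h5 := hasDerivAt_iff_tendsto_slope.1 (hder x hx z0 hz0b)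
      refine h5.comp (tendsto_nhdsWithin_iff.2 ⟨hseq', ?_⟩)
      exact Eventually.of_forall fun n => hne (n + N)
  · rw [uIoc_of_le hab]
    refine Eventually.of_forall fun x hx z hz => ?_
    have hsub : Metric.closedBall z (r / 2) ⊆ Metric.closedBall z0 r := by
      refine Metric.closedBall_subset_closedBall' ?_
      have := Metric.mem_ball.1 hz; linarith
    refine Complex.norm_deriv_le_of_forall_mem_sphere_norm_le hr2 ?_ ?_
    · refine DifferentiableOn.diffContOnCl ?_
      rw [closure_ball z hr2.ne']
      exact (hd x hx).mono (hsub.trans hrU)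
    · intro y hy
      exact hle x hx y (hsub (Metric.sphere_subset_closedBall hy))
  · exact hbd.div_const _
  · rw [uIoc_of_le hab]
    refine Eventually.of_forall fun x hx z hz => ?_
    exact hder x hx z (Metric.ball_subset_ball (by linarith) hz)

/-- half-disc -/
def HD (R : ℝ) : Set ℂ := {z | 0 < z.re ∧ ‖z‖ < R}

lemma HD_open (R : ℝ) : IsOpen (HD R) :=
  (isOpen_lt continuous_const Complex.continuous_re).inter (isOpen_lt continuous_norm continuous_const)

lemma HD_norm {R : ℝ} {z : ℂ} (hz : z ∈ HD R) : 0 < ‖z‖ :=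
  norm_pos_iff.2 (by rintro rfl; simpa using hz.1)

lemma HD_smul {R : ℝ} {z : ℂ} (hz : z ∈ HD R) {x : ℝ} (hx : x ∈ Ioc (0:ℝ) 1) : (x:ℂ) * z ∈ HD R := by
  refine ⟨?_, ?_⟩
  · have := mul_pos hx.1 hz.1
    simpa using this
  · rw [norm_mul, Complex.norm_real, Real.norm_eq_abs, abs_of_pos hx.1]
    have := mul_le_mul_of_nonneg_right hx.2 (norm_nonneg z)
    linarith [hz.2]

lemma HD_ball {R : ℝ} {z0 : ℂ} (hz : z0 ∈ HD R) : ∃ r > 0, Metric.closedBall z0 r ⊆ HD R ∧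
    ∃ m > 0, ∀ z ∈ Metric.closedBall z0 r, m ≤ ‖z‖ := by
  obtain ⟨r, hr, h⟩ := Metric.nhds_basis_closedBall.mem_iff.1
    ((HD_open R).mem_nhds hz)
  refine ⟨r, hr, h, ?_⟩
  have hcomp := isCompact_closedBall z0 r
  obtain ⟨z, hz1, hz2⟩ := hcomp.exists_isMinOn ⟨z0, Metric.mem_closedBall_self hr.le⟩
    continuous_norm.continuousOn
  exact ⟨‖z‖, HD_norm (h hz1), fun y hy => hz2 hy⟩

noncomputable def Vop (ρ : ℝ) (g : ℂ → ℂ) (z : ℂ) : ℂ :=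
  z ^ (ρ : ℂ) * ∫ x in (0:ℝ)..1, (((1 - x) ^ (ρ - 1) : ℝ) : ℂ) * g (x * z)

lemma Vop_meas {ρ R : ℝ} {g : ℂ → ℂ} (hg : DifferentiableOn ℂ g (HD R)) {z : ℂ} (hz : z ∈ HD R) :
    AEStronglyMeasurable (fun x : ℝ => (((1 - x) ^ (ρ - 1) : ℝ) : ℂ) * g (x * z))
      (volume.restrict (Ioc 0 1)) := by
  refine AEStronglyMeasurable.mul ?_ ?_
  · refine Measurable.aestronglyMeasurable ?_
    exact Complex.measurable_ofReal.comp (by fun_prop)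
  · refine ContinuousOn.aestronglyMeasurable ?_ measurableSet_Ioc
    exact hg.continuousOn.comp (by fun_prop) (fun x hx => HD_smul hz hx)

lemma Vop_hol {ρ R C : ℝ} (h0 : 0 < ρ) (h1 : ρ < 1) {g : ℂ → ℂ} (hg : DifferentiableOn ℂ g (HD R))
    (hb : ∀ z ∈ HD R, ‖g z‖ ≤ C * ‖z‖ ^ (-ρ)) : DifferentiableOn ℂ (Vop ρ g) (HD R) := by
  refine DifferentiableOn.mul ?_ ?_
  · intro z hz
    refine DifferentiableAt.differentiableWithinAt ?_
    exact differentiableAt_id.cpow_const (Or.inl hz.1)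
  · refine hol_int zero_le_one ?_ (fun z hz => Vop_meas hg hz) ?_
    · intro x hx
      refine DifferentiableOn.const_mul ?_ _
      exact hg.comp (by fun_prop) (fun z hz => HD_smul hz hx)
    · intro z0 hz0
      obtain ⟨r, hr, hrU, m, hm, hle⟩ := HD_ball hz0
      refine ⟨r, hr, hrU, fun x => |C| * m ^ (-ρ) * ((1 - x) ^ (ρ - 1) * x ^ (-ρ)), ?_, ?_⟩
      · have := ii_beta (a := ρ - 1) (b := -ρ) (by linarith) (by linarith) (zero_lt_one (α := ℝ))
        simp only [sub_zero] at this
        exact this.const_mul _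
      · intro x hx z hz
        have hn : 0 ≤ (1 - x) ^ (ρ - 1) := Real.rpow_nonneg (by linarith [hx.2]) _
        rw [norm_mul, Complex.norm_real, Real.norm_eq_abs, abs_of_nonneg hn]
        have h2 := hb _ (HD_smul (hrU hz) hx)
        rw [norm_mul, Complex.norm_real, Real.norm_eq_abs, abs_of_pos hx.1,
          Real.mul_rpow hx.1.le (norm_nonneg _)] at h2
        have h3 : ‖z‖ ^ (-ρ) ≤ m ^ (-ρ) :=
          Real.rpow_le_rpow_of_nonpos hm (hle z hz) (by linarith)
        have hxn : 0 ≤ x ^ (-ρ) := Real.rpow_nonneg hx.1.le _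
        have hzn : 0 ≤ ‖z‖ ^ (-ρ) := Real.rpow_nonneg (norm_nonneg _) _
        calc _ ≤ (1 - x) ^ (ρ - 1) * (C * (x ^ (-ρ) * ‖z‖ ^ (-ρ))) := by gcongr
          _ ≤ (1 - x) ^ (ρ - 1) * (|C| * (x ^ (-ρ) * m ^ (-ρ))) := by
            gcongr
            exact le_abs_self C
          _ = _ := by ring

lemma Vop_bd {ρ R C : ℝ} (h0 : 0 < ρ) (h1 : ρ < 1) {g : ℂ → ℂ}
    (hb : ∀ z ∈ HD R, ‖g z‖ ≤ C * ‖z‖ ^ (-ρ)) : ∀ z ∈ HD R, ‖Vop ρ g z‖ ≤ C * Bt ρ := by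
  intro z hz
  have hzp := HD_norm hz
  rw [Vop, norm_mul, Complex.norm_cpow_real]
  have e : ‖∫ x in (0:ℝ)..1, (((1 - x) ^ (ρ - 1) : ℝ) : ℂ) * g (x * z)‖ ≤
      ∫ x in (0:ℝ)..1, C * ‖z‖ ^ (-ρ) * ((1 - x) ^ (ρ - 1) * x ^ (-ρ)) := by
    refine intervalIntegral.norm_integral_le_of_norm_le zero_le_one ?_ ?_
    · refine Eventually.of_forall fun x hx => ?_
      have hn : 0 ≤ (1 - x) ^ (ρ - 1) := Real.rpow_nonneg (by linarith [hx.2]) _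
      rw [norm_mul, Complex.norm_real, Real.norm_eq_abs, abs_of_nonneg hn]
      have h2 := hb _ (HD_smul hz hx)
      rw [norm_mul, Complex.norm_real, Real.norm_eq_abs, abs_of_pos hx.1,
        Real.mul_rpow hx.1.le (norm_nonneg _)] at h2
      calc _ ≤ (1 - x) ^ (ρ - 1) * (C * (x ^ (-ρ) * ‖z‖ ^ (-ρ))) := by gcongr
        _ = _ := by ring
    · have := ii_beta (a := ρ - 1) (b := -ρ) (by linarith) (by linarith) (zero_lt_one (α := ℝ))
      simp only [sub_zero] at this
      exact this.const_mul _
  rw [intervalIntegral.integral_const_mul] at e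
  have e2 : ‖z‖ ^ ρ * ‖z‖ ^ (-ρ) = 1 := by rw [← Real.rpow_add hzp]; simp
  calc _ ≤ ‖z‖ ^ ρ * (C * ‖z‖ ^ (-ρ) * Bt ρ) := by gcongr; exact e
    _ = (‖z‖ ^ ρ * ‖z‖ ^ (-ρ)) * (C * Bt ρ) := by ring
    _ = _ := by rw [e2, one_mul]

/-- scaling -/
lemma scale_int {ρ r : ℝ} (hr : 0 < r) (f : ℝ → ℝ) :
    r ^ ρ * ∫ x in (0:ℝ)..1, (1 - x) ^ (ρ - 1) * f (x * r) = ∫ s in (0:ℝ)..r, (r - s) ^ (ρ - 1) * f s := by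
  have := intervalIntegral.smul_integral_comp_mul_add (a := 0) (b := 1)
    (fun s => (r - s) ^ (ρ - 1) * f s) r 0
  simp only [mul_zero, mul_one, add_zero] at this
  rw [← this, smul_eq_mul, ← intervalIntegral.integral_const_mul, ← intervalIntegral.integral_const_mul]
  refine intervalIntegral.integral_congr fun x hx => ?_
  rw [uIcc_of_le zero_le_one] at hx
  have e1 : r - r * x = r * (1 - x) := by ring
  rw [e1, Real.mul_rpow hr.le (by linarith [hx.2]), Real.rpow_sub_one hr.ne', mul_comm x r]
  field_simp

lemma Vop_exp {ρ R C K ε : ℝ} (h0 : 0 < ρ) {g : ℂ → ℂ} (hC : 0 ≤ C)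
    (hest : ∀ t : ℝ, 0 ≤ t →
      ∫ s in (0:ℝ)..t, (t - s) ^ (ρ - 1) * Real.exp (K * s) ≤ ε * Real.exp (K * t))
    (hb : ∀ z ∈ HD R, ‖g z‖ ≤ C * Real.exp (K * ‖z‖)) :
    ∀ z ∈ HD R, ‖Vop ρ g z‖ ≤ (C * ε) * Real.exp (K * ‖z‖) := by
  intro z hz
  have hzp := HD_norm hz
  rw [Vop, norm_mul, Complex.norm_cpow_real]
  have e : ‖∫ x in (0:ℝ)..1, (((1 - x) ^ (ρ - 1) : ℝ) : ℂ) * g (x * z)‖ ≤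
      ∫ x in (0:ℝ)..1, C * ((1 - x) ^ (ρ - 1) * Real.exp (K * (x * ‖z‖))) := by
    refine intervalIntegral.norm_integral_le_of_norm_le zero_le_one ?_ ?_
    · refine Eventually.of_forall fun x hx => ?_
      have hn : 0 ≤ (1 - x) ^ (ρ - 1) := Real.rpow_nonneg (by linarith [hx.2]) _
      rw [norm_mul, Complex.norm_real, Real.norm_eq_abs, abs_of_nonneg hn]
      have h2 := hb _ (HD_smul hz hx)
      rw [norm_mul, Complex.norm_real, Real.norm_eq_abs, abs_of_pos hx.1] at h2
      calc _ ≤ (1 - x) ^ (ρ - 1) * (C * Real.exp (K * (x * ‖z‖))) := by gcongr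
        _ = _ := by ring
    · exact ((ii_rpow_right (by linarith) 0 1).mul_continuousOn (by fun_prop)).const_mul _
  rw [intervalIntegral.integral_const_mul] at e
  have e2 := scale_int (ρ := ρ) hzp (fun s => Real.exp (K * s))
  have e3 := hest ‖z‖ hzp.le
  calc _ ≤ ‖z‖ ^ ρ * (C * ∫ x in (0:ℝ)..1, (1 - x) ^ (ρ - 1) * Real.exp (K * (x * ‖z‖))) := by
        gcongr
    _ = C * (‖z‖ ^ ρ * ∫ x in (0:ℝ)..1, (1 - x) ^ (ρ - 1) * Real.exp (K * (x * ‖z‖))) := by ring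
    _ ≤ C * (ε * Real.exp (K * ‖z‖)) := by rw [e2]; gcongr
    _ = _ := by ring


lemma bd_pow {ρ R M : ℝ} (h0 : 0 < ρ) (hM : 0 ≤ M) {z : ℂ} (hz : z ∈ HD R) :
    M ≤ M * R ^ ρ * ‖z‖ ^ (-ρ) := by
  have hzp := HD_norm hz
  have h2 : ‖z‖ ^ ρ ≤ R ^ ρ := Real.rpow_le_rpow hzp.le hz.2.le h0.le
  have e2 : ‖z‖ ^ ρ * ‖z‖ ^ (-ρ) = 1 := by rw [← Real.rpow_add hzp]; simp
  have h3 := mul_le_mul_of_nonneg_right h2 (Real.rpow_nonneg hzp.le (-ρ))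
  rw [e2] at h3
  have := mul_le_mul_of_nonneg_left h3 hM
  linarith

lemma Vop_int {ρ R C : ℝ} (h0 : 0 < ρ) (h1 : ρ < 1) {g : ℂ → ℂ} (hg : DifferentiableOn ℂ g (HD R))
    (hb : ∀ z ∈ HD R, ‖g z‖ ≤ C * ‖z‖ ^ (-ρ)) {z : ℂ} (hz : z ∈ HD R) :
    IntervalIntegrable (fun x : ℝ => (((1 - x) ^ (ρ - 1) : ℝ) : ℂ) * g (x * z)) volume 0 1 := by
  have hbd : IntervalIntegrable (fun x : ℝ => C * ‖z‖ ^ (-ρ) * ((1 - x) ^ (ρ - 1) * x ^ (-ρ)))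
      volume 0 1 := by
    have := ii_beta (a := ρ - 1) (b := -ρ) (by linarith) (by linarith) (zero_lt_one (α := ℝ))
    simp only [sub_zero] at this
    exact this.const_mul _
  rw [intervalIntegrable_iff_integrableOn_Ioc_of_le zero_le_one] at hbd ⊢
  refine Integrable.mono' hbd (Vop_meas hg hz) ?_
  filter_upwards [ae_restrict_mem measurableSet_Ioc] with x hx
  have hn : 0 ≤ (1 - x) ^ (ρ - 1) := Real.rpow_nonneg (by linarith [hx.2]) _
  rw [norm_mul, Complex.norm_real, Real.norm_eq_abs, abs_of_nonneg hn]
  have h2 := hb _ (HD_smul hz hx)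
  rw [norm_mul, Complex.norm_real, Real.norm_eq_abs, abs_of_pos hx.1,
    Real.mul_rpow hx.1.le (norm_nonneg _)] at h2
  calc _ ≤ (1 - x) ^ (ρ - 1) * (C * (x ^ (-ρ) * ‖z‖ ^ (-ρ))) := by gcongr
    _ = _ := by ring

noncomputable def iter (ρ lam B : ℝ) (q : ℂ → ℂ) : ℕ → ℂ → ℂ
  | 0 => fun z => ((1 / B : ℝ) : ℂ) * Vop ρ q z
  | n + 1 => fun z => ((-(lam / B) : ℝ) : ℂ) * Vop ρ (iter ρ lam B q n) z

lemma volterra {ρ R C lam B : ℝ} (h0 : 0 < ρ) (h1 : ρ < 1) (hR : 0 < R) (hB : 0 < B) {q : ℂ → ℂ}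
    (hq : DifferentiableOn ℂ q (HD R)) (hC : 0 ≤ C)
    (hb : ∀ z ∈ HD R, ‖q z‖ ≤ C * ‖z‖ ^ (-ρ)) :
    ∃ G : ℂ → ℂ, DifferentiableOn ℂ G (HD R) ∧ (∃ M, ∀ z ∈ HD R, ‖G z‖ ≤ M) ∧
      ∀ z ∈ HD R, (B : ℂ) * G z = Vop ρ (fun z => q z - lam * G z) z := by
  obtain ⟨K, hK, hest⟩ := exp_est h0 (ε := B / (2 * (|lam| + 1))) (by positivity)
  set d := iter ρ lam B q with hd
  set M := C * Bt ρ / B with hM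
  have hM0 : 0 ≤ M := by have := (Bt_pos h0 h1).le; positivity
  have hbound : ∀ n, ∀ z ∈ HD R, ‖d n z‖ ≤ (M * (1 / 2) ^ n) * Real.exp (K * ‖z‖) := by
    intro n
    induction n with
    | zero =>
      intro z hz
      have h2 := Vop_bd h0 h1 hb z hz
      have h3 : ‖d 0 z‖ = (1 / B) * ‖Vop ρ q z‖ := by
        simp only [hd, iter]
        rw [norm_mul, Complex.norm_real, Real.norm_eq_abs, abs_of_pos (by positivity)]
      rw [h3]
      have h4 : 1 ≤ Real.exp (K * ‖z‖) := Real.one_le_exp (by positivity)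
      calc 1 / B * ‖Vop ρ q z‖ ≤ 1 / B * (C * Bt ρ) := by gcongr
        _ = M * 1 := by rw [hM]; ring
        _ ≤ M * Real.exp (K * ‖z‖) := by gcongr
        _ = _ := by ring
    | succ n ih =>
      intro z hz
      have h2 := Vop_exp h0 (by positivity) hest ih z hz
      have h3 : ‖d (n + 1) z‖ = (|lam| / B) * ‖Vop ρ (d n) z‖ := by
        simp only [hd, iter]
        rw [norm_mul, Complex.norm_real, Real.norm_eq_abs, abs_neg, abs_div, abs_of_pos hB]
      rw [h3]
      have e5 : |lam| / (|lam| + 1) ≤ 1 := by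
        rw [div_le_one (by positivity)]; linarith [abs_nonneg lam]
      calc |lam| / B * ‖Vop ρ (d n) z‖
          ≤ |lam| / B * (M * (1 / 2) ^ n * (B / (2 * (|lam| + 1))) * Real.exp (K * ‖z‖)) := by gcongr
        _ = (|lam| / (|lam| + 1)) * ((M * (1 / 2) ^ (n + 1)) * Real.exp (K * ‖z‖)) := by
          field_simp; ring
        _ ≤ 1 * ((M * (1 / 2) ^ (n + 1)) * Real.exp (K * ‖z‖)) := by gcongr
        _ = _ := one_mul _
  set M1 := M * Real.exp (K * R) with hM1
  have hM10 : 0 ≤ M1 := by positivity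
  have hb1 : ∀ n, ∀ z ∈ HD R, ‖d n z‖ ≤ M1 * (1 / 2) ^ n := by
    intro n z hz
    refine (hbound n z hz).trans ?_
    have : Real.exp (K * ‖z‖) ≤ Real.exp (K * R) :=
      Real.exp_le_exp.2 (mul_le_mul_of_nonneg_left hz.2.le hK.le)
    calc _ ≤ (M * (1 / 2) ^ n) * Real.exp (K * R) := by gcongr
      _ = _ := by rw [hM1]; ring
  have hb2 : ∀ n, ∀ z ∈ HD R, ‖d n z‖ ≤ (M1 * (1 / 2) ^ n * R ^ ρ) * ‖z‖ ^ (-ρ) := fun n z hz =>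
    (hb1 n z hz).trans (bd_pow h0 (by positivity) hz)
  have hhol : ∀ n, DifferentiableOn ℂ (d n) (HD R) := by
    intro n
    induction n with
    | zero => exact (Vop_hol h0 h1 hq hb).const_mul _
    | succ n ih => exact (Vop_hol h0 h1 ih (hb2 n)).const_mul _
  have hsum : Summable (fun n : ℕ => M1 * (1 / 2 : ℝ) ^ n) := summable_geometric_two.mul_left _
  have hS : ∀ z ∈ HD R, HasSum (fun n => d n z) (∑' n, d n z) := fun z hz =>
    (Summable.of_norm_bounded hsum (fun n => hb1 n z hz)).hasSum
  set G : ℂ → ℂ := fun z => ∑' n, d n z with hG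
  have hGhol : DifferentiableOn ℂ G (HD R) :=
    Complex.differentiableOn_tsum_of_summable_norm hsum hhol (HD_open R) hb1
  have hGb : ∀ z ∈ HD R, ‖G z‖ ≤ M1 * 2 := by
    intro z hz
    have := tsum_of_norm_bounded (summable_geometric_two.hasSum.mul_left M1) (fun n => hb1 n z hz)
    rwa [tsum_geometric_two] at this
  refine ⟨G, hGhol, ⟨_, hGb⟩, ?_⟩
  intro z hz
  have hGb2 : ∀ z ∈ HD R, ‖G z‖ ≤ (M1 * 2 * R ^ ρ) * ‖z‖ ^ (-ρ) := fun z hz =>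
    (hGb z hz).trans (bd_pow h0 (by positivity) hz)
  have hV : HasSum (fun n => ∫ x in (0:ℝ)..1, (((1 - x) ^ (ρ - 1) : ℝ) : ℂ) * d n (x * z))
      (∫ x in (0:ℝ)..1, (((1 - x) ^ (ρ - 1) : ℝ) : ℂ) * G (x * z)) := by
    refine intervalIntegral.hasSum_integral_of_dominated_convergence
      (fun n x => (1 - x) ^ (ρ - 1) * (M1 * (1 / 2) ^ n)) ?_ ?_ ?_ ?_ ?_
    · intro n; rw [uIoc_of_le zero_le_one]; exact Vop_meas (hhol n) hz
    · intro n
      refine Eventually.of_forall fun x hx => ?_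
      rw [uIoc_of_le zero_le_one] at hx
      have hn : 0 ≤ (1 - x) ^ (ρ - 1) := Real.rpow_nonneg (by linarith [hx.2]) _
      rw [norm_mul, Complex.norm_real, Real.norm_eq_abs, abs_of_nonneg hn]
      exact mul_le_mul_of_nonneg_left (hb1 n _ (HD_smul hz hx)) hn
    · exact Eventually.of_forall fun x hx => hsum.mul_left _
    · simp only [tsum_mul_left, tsum_geometric_two]
      exact (ii_rpow_right (by linarith) 0 1).mul_const _
    · refine Eventually.of_forall fun x hx => ?_
      rw [uIoc_of_le zero_le_one] at hx
      exact (hS _ (HD_smul hz hx)).mul_left _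
  have h5 : HasSum (fun n => d (n + 1) z) (((-(lam / B) : ℝ) : ℂ) * Vop ρ G z) :=
    (hV.mul_left (z ^ (ρ : ℂ))).mul_left _
  have h6 : G z = d 0 z + ((-(lam / B) : ℝ) : ℂ) * Vop ρ G z := by
    rw [hG]; simp only []
    rw [(hS z hz).summable.tsum_eq_zero_add, h5.tsum_eq]
  have h7 : Vop ρ (fun z => q z - lam * G z) z = Vop ρ q z - lam * Vop ρ G z := by
    have i1 := Vop_int h0 h1 hq hb hz
    have i2 := (Vop_int h0 h1 hGhol hGb2 hz).const_mul (lam : ℂ)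
    simp only [Vop]
    have i3 := intervalIntegral.integral_sub i1 i2
    rw [intervalIntegral.integral_const_mul] at i3
    rw [mul_left_comm (lam : ℂ), ← mul_sub, ← i3]
    congr 2; ext x; ring
  have hBc : (B : ℂ) ≠ 0 := by exact_mod_cast hB.ne'
  have h8 : d 0 z = ((1 / B : ℝ) : ℂ) * Vop ρ q z := rfl
  rw [h7, h6, h8]
  push_cast
  field_simp
  ring


noncomputable def Qc (w : ℝ → ℝ) (t0 ρ : ℝ) (z : ℂ) : ℂ :=
  ∫ ξ in (0:ℝ)..t0, (w ξ : ℂ) * (((t0 - ξ : ℝ) : ℂ) + z) ^ ((-ρ - 1 : ℝ) : ℂ)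

noncomputable def Qr (w : ℝ → ℝ) (t0 ρ : ℝ) (x : ℝ) : ℝ :=
  ∫ ξ in (0:ℝ)..t0, (t0 + x - ξ) ^ (-ρ - 1) * w ξ

lemma Qc_real (w : ℝ → ℝ) {t0 : ℝ} (ht0 : 0 < t0) (ρ : ℝ) {x : ℝ} (hx : 0 < x) :
    Qc w t0 ρ x = (Qr w t0 ρ x : ℂ) := by
  rw [Qc, Qr, ← intervalIntegral.integral_ofReal]
  refine intervalIntegral.integral_congr fun ξ hξ => ?_
  rw [uIcc_of_le ht0.le] at hξ
  simp only [Complex.ofReal_mul]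
  rw [Complex.ofReal_cpow (by linarith [hξ.2]), mul_comm]
  congr 2
  push_cast; ring

lemma norm_add_ge {z : ℂ} (hz : 0 < z.re) {y : ℝ} (hy : 0 ≤ y) : (‖z‖ + y) / 2 ≤ ‖(y : ℂ) + z‖ := by
  have a : y ≤ ‖(y : ℂ) + z‖ := by
    have := (le_abs_self _).trans (Complex.abs_re_le_norm ((y : ℂ) + z))
    simp at this; linarith
  have b : ‖z‖ ≤ ‖(y : ℂ) + z‖ := by
    refine (sq_le_sq₀ (norm_nonneg _) (norm_nonneg _)).1 ?_
    rw [Complex.sq_norm, Complex.sq_norm, Complex.normSq_apply, Complex.normSq_apply]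
    simp
    nlinarith
  linarith

lemma Qker_bd {z : ℂ} (hz : 0 < z.re) {y ρ : ℝ} (hy : 0 ≤ y) (h0 : 0 < ρ) :
    ‖((y : ℂ) + z) ^ ((-ρ - 1 : ℝ) : ℂ)‖ ≤ 2 ^ (ρ + 1) * (‖z‖ + y) ^ (-ρ - 1) := by
  have hzp : 0 < ‖z‖ := norm_pos_iff.2 (by rintro rfl; simp at hz)
  rw [Complex.norm_cpow_real]
  have h1 := Real.rpow_le_rpow_of_nonpos (z := -ρ - 1) (by positivity : 0 < (‖z‖ + y) / 2)
    (norm_add_ge hz hy) (by linarith)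
  refine h1.trans (le_of_eq ?_)
  rw [Real.div_rpow (by positivity) (by norm_num), div_eq_mul_inv, ← Real.rpow_neg (by norm_num),
    mul_comm]
  congr 2; ring

lemma Q_meas {w : ℝ → ℝ} {t0 ρ : ℝ} (ht0 : 0 < t0)
    (wi : IntervalIntegrable w volume 0 t0) {z : ℂ} (hz : 0 < z.re) :
    AEStronglyMeasurable (fun ξ : ℝ => (w ξ : ℂ) * (((t0 - ξ : ℝ) : ℂ) + z) ^ ((-ρ - 1 : ℝ) : ℂ))
      (volume.restrict (Ioc 0 t0)) := by
  have := wi.aestronglyMeasurable_restrict_uIoc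
  rw [uIoc_of_le ht0.le] at this
  refine AEStronglyMeasurable.mul (Complex.continuous_ofReal.comp_aestronglyMeasurable this) ?_
  refine ContinuousOn.aestronglyMeasurable ?_ measurableSet_Ioc
  refine ContinuousOn.cpow_const (by fun_prop) ?_
  intro ξ hξ
  left
  simp
  linarith [hξ.2]

lemma Q_hol {w : ℝ → ℝ} {t0 ρ R : ℝ} (ht0 : 0 < t0) (h0 : 0 < ρ)
    (wi : IntervalIntegrable w volume 0 t0) : DifferentiableOn ℂ (Qc w t0 ρ) (HD R) := by
  refine hol_int ht0.le ?_ (fun z hz => Q_meas ht0 wi hz.1) ?_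
  · intro ξ hξ
    refine DifferentiableOn.const_mul ?_ _
    refine DifferentiableOn.cpow_const (by fun_prop) ?_
    intro z hz
    left
    have := hz.1
    simp
    linarith [hξ.2]
  · intro z0 hz0
    obtain ⟨r, hr, hrU, m, hm, hle⟩ := HD_ball hz0
    refine ⟨r, hr, hrU, fun ξ => 2 ^ (ρ + 1) * m ^ (-ρ - 1) * ‖w ξ‖, wi.norm.const_mul _, ?_⟩
    intro ξ hξ z hz
    rw [norm_mul, Complex.norm_real, mul_comm]
    refine mul_le_mul_of_nonneg_right ?_ (norm_nonneg _)
    refine (Qker_bd (hrU hz).1 (by linarith [hξ.2]) h0).trans ?_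
    refine mul_le_mul_of_nonneg_left ?_ (by positivity)
    refine Real.rpow_le_rpow_of_nonpos hm ?_ (by linarith)
    have := hle z hz
    linarith [hξ.2]

lemma Q_bd {w : ℝ → ℝ} {t0 ρ R : ℝ} (ht0 : 0 < t0) (h0 : 0 < ρ)
    (wi : IntervalIntegrable w volume 0 t0) (wc : ContinuousOn w (Ioc 0 t0)) :
    ∃ C, 0 ≤ C ∧ ∀ z ∈ HD R, ‖Qc w t0 ρ z‖ ≤ C * ‖z‖ ^ (-ρ) := by
  obtain ⟨M, hM⟩ := (isCompact_Icc (a := t0 / 2) (b := t0)).exists_bound_of_continuousOn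
    (wc.mono fun x hx => ⟨by linarith [hx.1], hx.2⟩)
  have hM0 : 0 ≤ M := (norm_nonneg _).trans (hM t0 ⟨by linarith, le_rfl⟩)
  set A := ∫ ξ in (0:ℝ)..(t0 / 2), ‖w ξ‖ with hA
  have hA0 : 0 ≤ A := intervalIntegral.integral_nonneg (by linarith) fun x _ => norm_nonneg _
  set C1 := 2 ^ (ρ + 1) * ((t0 / 2) ^ (-ρ - 1) * A) with hC1
  have hC10 : 0 ≤ C1 := by positivity
  have hRle : 0 ≤ |R| ^ ρ := by positivity
  refine ⟨C1 * |R| ^ ρ + 2 ^ (ρ + 1) * (M / ρ), by positivity, ?_⟩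
  intro z hz
  have hzp := HD_norm hz
  have hR : 0 < R := hzp.trans hz.2
  have wi1 := ii_sub wi le_rfl (by linarith : 0 ≤ t0 / 2) (by linarith)
  have wi2 := ii_sub wi (by linarith : 0 ≤ t0 / 2) (by linarith : t0 / 2 ≤ t0) le_rfl
  have kc : ∀ a b : ℝ, a ≤ b → b ≤ t0 → ContinuousOn (fun ξ : ℝ => (‖z‖ + (t0 - ξ)) ^ (-ρ - 1)) (Icc a b) := by
    intro a b hab hb
    refine ContinuousOn.rpow_const (by fun_prop) ?_
    intro ξ hξ; left; have := hξ.2; intro h; linarith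
  have j1 : IntervalIntegrable (fun ξ => 2 ^ (ρ + 1) * (‖z‖ + (t0 - ξ)) ^ (-ρ - 1) * ‖w ξ‖) volume 0 (t0 / 2) := by
    refine wi1.norm.continuousOn_mul ?_
    rw [uIcc_of_le (by linarith)]
    exact continuousOn_const.mul (kc _ _ (by linarith) (by linarith))
  have j2 : IntervalIntegrable (fun ξ => 2 ^ (ρ + 1) * (‖z‖ + (t0 - ξ)) ^ (-ρ - 1) * ‖w ξ‖) volume (t0 / 2) t0 := by
    refine wi2.norm.continuousOn_mul ?_
    rw [uIcc_of_le (by linarith)]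
    exact continuousOn_const.mul (kc _ _ (by linarith) (by linarith))
  have e0 : ‖Qc w t0 ρ z‖ ≤ ∫ ξ in (0:ℝ)..t0, 2 ^ (ρ + 1) * (‖z‖ + (t0 - ξ)) ^ (-ρ - 1) * ‖w ξ‖ := by
    refine intervalIntegral.norm_integral_le_of_norm_le ht0.le ?_ (j1.trans j2)
    refine Eventually.of_forall fun ξ hξ => ?_
    rw [norm_mul, Complex.norm_real, mul_comm]
    exact mul_le_mul_of_nonneg_right (Qker_bd hz.1 (by linarith [hξ.2]) h0) (norm_nonneg _)
  rw [← intervalIntegral.integral_add_adjacent_intervals j1 j2] at e0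
  have e1 : ∫ ξ in (0:ℝ)..(t0 / 2), 2 ^ (ρ + 1) * (‖z‖ + (t0 - ξ)) ^ (-ρ - 1) * ‖w ξ‖ ≤ C1 := by
    have : C1 = ∫ ξ in (0:ℝ)..(t0 / 2), 2 ^ (ρ + 1) * (t0 / 2) ^ (-ρ - 1) * ‖w ξ‖ := by
      rw [intervalIntegral.integral_const_mul, hC1]; ring
    rw [this]
    refine intervalIntegral.integral_mono_on (by linarith) j1 (wi1.norm.const_mul _) ?_
    intro ξ hξ
    refine mul_le_mul_of_nonneg_right ?_ (norm_nonneg _)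
    refine mul_le_mul_of_nonneg_left ?_ (by positivity)
    exact Real.rpow_le_rpow_of_nonpos (by linarith) (by linarith [hξ.2]) (by linarith)
  have e2 : ∫ ξ in (t0 / 2)..t0, 2 ^ (ρ + 1) * (‖z‖ + (t0 - ξ)) ^ (-ρ - 1) * ‖w ξ‖
      ≤ 2 ^ (ρ + 1) * (M / ρ) * ‖z‖ ^ (-ρ) := by
    have b1 : ∫ ξ in (t0 / 2)..t0, 2 ^ (ρ + 1) * (‖z‖ + (t0 - ξ)) ^ (-ρ - 1) * ‖w ξ‖ ≤
        ∫ ξ in (t0 / 2)..t0, 2 ^ (ρ + 1) * M * (‖z‖ + t0 - ξ) ^ (-ρ - 1) := by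
      refine intervalIntegral.integral_mono_on (by linarith) j2 ?_ ?_
      · refine ContinuousOn.intervalIntegrable ?_
        rw [uIcc_of_le (by linarith)]
        have := kc (t0/2) t0 (by linarith) le_rfl
        simp only [← add_sub_assoc] at this
        exact continuousOn_const.mul this
      · intro ξ hξ
        have hk : 0 ≤ (‖z‖ + t0 - ξ) ^ (-ρ - 1) := Real.rpow_nonneg (by linarith [hξ.2]) _
        have := hM ξ hξ
        rw [← add_sub_assoc]
        calc _ ≤ 2 ^ (ρ + 1) * (‖z‖ + t0 - ξ) ^ (-ρ - 1) * M := by gcongr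
          _ = _ := by ring
    refine b1.trans ?_
    rw [intervalIntegral.integral_const_mul,
      intervalIntegral.integral_comp_sub_left (fun x : ℝ => x ^ (-ρ - 1)) (‖z‖ + t0),
      integral_rpow (Or.inr ⟨by linarith, ?_⟩)]
    · have c1 : ‖z‖ + t0 - t0 = ‖z‖ := by ring
      have c2 : -ρ - 1 + 1 = -ρ := by ring
      rw [c1, c2]
      have c3 : 0 ≤ (‖z‖ + t0 - t0 / 2) ^ (-ρ) := Real.rpow_nonneg (by linarith) _
      have c4 : ((‖z‖ + t0 - t0 / 2) ^ (-ρ) - ‖z‖ ^ (-ρ)) / (-ρ) =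
        (‖z‖ ^ (-ρ) - (‖z‖ + t0 - t0 / 2) ^ (-ρ)) / ρ := by field_simp; ring
      rw [c4]
      calc _ ≤ 2 ^ (ρ + 1) * M * (‖z‖ ^ (-ρ) / ρ) := by gcongr; linarith
        _ = _ := by ring
    · rw [uIcc_of_le (by linarith)]
      intro h; have := h.1; linarith
  have e3 := bd_pow h0 hC10 hz
  rw [abs_of_pos hR]
  calc _ ≤ C1 * R ^ ρ * ‖z‖ ^ (-ρ) + 2 ^ (ρ + 1) * (M / ρ) * ‖z‖ ^ (-ρ) := by linarith
    _ = _ := by ring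


lemma ofReal_HD {R x : ℝ} (hx : x ∈ Ioo 0 R) : (x : ℂ) ∈ HD R := by
  refine ⟨by simpa using hx.1, ?_⟩
  rw [Complex.norm_real, Real.norm_eq_abs, abs_of_pos hx.1]; exact hx.2

lemma ana {w : ℝ → ℝ} {t0 ρ R : ℝ} (lam : ℝ) (ht0 : 0 < t0) (h0 : 0 < ρ) (h1 : ρ < 1) (hR : 0 < R)
    (wi : IntervalIntegrable w volume 0 t0) (wc : ContinuousOn w (Ioc 0 t0)) :
    ∃ g : ℝ → ℝ, AnalyticOnNhd ℝ g (Ioo 0 R) ∧ (∃ M, ∀ x ∈ Ioo 0 R, |g x| ≤ M) ∧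
      ∀ s ∈ Ioo 0 R, IntervalIntegrable (fun x => ρ * Qr w t0 ρ x - lam * g x) volume 0 s ∧
        FI ρ g s = ∫ x in (0:ℝ)..s, (ρ * Qr w t0 ρ x - lam * g x) := by
  obtain ⟨C, hC0, hC⟩ := Q_bd (R := R) ht0 h0 wi wc
  have hB : 0 < Bt (1 - ρ) := Bt_pos (by linarith) (by linarith)
  set q : ℂ → ℂ := fun z => (ρ : ℂ) * Qc w t0 ρ z with hq
  have qhol : DifferentiableOn ℂ q (HD R) := (Q_hol ht0 h0 wi).const_mul _
  have qb : ∀ z ∈ HD R, ‖q z‖ ≤ (ρ * C) * ‖z‖ ^ (-ρ) := by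
    intro z hz
    rw [hq]; simp only []
    rw [norm_mul, Complex.norm_real, Real.norm_eq_abs, abs_of_pos h0, mul_assoc]
    exact mul_le_mul_of_nonneg_left (hC z hz) h0.le
  obtain ⟨G, Ghol, ⟨M, GM⟩, Geq⟩ := volterra (lam := lam) h0 h1 hR hB qhol (by positivity) qb
  set F : ℂ → ℂ := fun z => q z - lam * G z with hF
  have Fhol : DifferentiableOn ℂ F (HD R) := qhol.sub (Ghol.const_mul _)
  set C2 := ρ * C + |lam| * |M| * R ^ ρ with hC2
  have Fb : ∀ z ∈ HD R, ‖F z‖ ≤ C2 * ‖z‖ ^ (-ρ) := by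
    intro z hz
    have a1 := qb z hz
    have a2 := bd_pow h0 (by positivity : 0 ≤ |lam| * |M|) hz
    have a3 : ‖(lam : ℂ) * G z‖ ≤ |lam| * |M| := by
      rw [norm_mul, Complex.norm_real, Real.norm_eq_abs]
      exact mul_le_mul_of_nonneg_left ((GM z hz).trans (le_abs_self M)) (abs_nonneg _)
    have a4 := norm_sub_le (q z) (lam * G z)
    simp only [hF]
    calc _ ≤ (ρ * C) * ‖z‖ ^ (-ρ) + |lam| * |M| * R ^ ρ * ‖z‖ ^ (-ρ) := by linarith
      _ = _ := by rw [hC2]; ring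
  set g : ℝ → ℝ := fun x => (G x).re with hg
  set f : ℝ → ℝ := fun x => (F x).re with hf
  have fval : ∀ x, 0 < x → f x = ρ * Qr w t0 ρ x - lam * g x := by
    intro x hx
    simp only [hf, hF, hq, hg]
    rw [Qc_real w ht0 ρ hx, ← Complex.ofReal_mul]
    simp
  have fcont : ContinuousOn f (Ioo 0 R) :=
    Complex.continuous_re.comp_continuousOn (Fhol.continuousOn.comp
      Complex.continuous_ofReal.continuousOn (fun x hx => ofReal_HD hx))
  have fii : ∀ s ∈ Ioo 0 R, IntervalIntegrable f volume 0 s := by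
    intro s hs
    have : IntervalIntegrable (fun x : ℝ => C2 * x ^ (-ρ)) volume 0 s :=
      (intervalIntegral.intervalIntegrable_rpow' (by linarith)).const_mul _
    rw [intervalIntegrable_iff_integrableOn_Ioc_of_le hs.1.le] at this ⊢
    refine Integrable.mono' this ?_ ?_
    · refine ContinuousOn.aestronglyMeasurable ?_ measurableSet_Ioc
      exact fcont.mono fun x hx => ⟨hx.1, by linarith [hx.2, hs.2]⟩
    · filter_upwards [ae_restrict_mem measurableSet_Ioc] with x hx
      have h3 := Fb x (ofReal_HD ⟨hx.1, by linarith [hx.2, hs.2]⟩)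
      rw [Complex.norm_real, Real.norm_eq_abs, abs_of_pos hx.1] at h3
      exact (Complex.abs_re_le_norm _).trans h3
  have geq : ∀ x ∈ Ioo 0 R, FI (1 - ρ) f x = Bt (1 - ρ) * g x := by
    intro x hx
    have e1 := Geq x (ofReal_HD hx)
    have e2 := congrArg Complex.re e1
    rw [Complex.re_ofReal_mul] at e2
    have e3 : (Vop ρ F x).re = x ^ ρ * ∫ y in (0:ℝ)..1, (1 - y) ^ (ρ - 1) * f (y * x) := by
      rw [Vop, ← Complex.ofReal_cpow hx.1.le, Complex.re_ofReal_mul]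
      congr 1
      have := (Complex.reCLM).intervalIntegral_comp_comm (Vop_int h0 h1 Fhol Fb (ofReal_HD hx))
      simp only [Complex.reCLM_apply] at this
      rw [← this]
      congr 1; ext y
      rw [Complex.re_ofReal_mul, hf]
      simp
    rw [scale_int hx.1] at e3
    have e4 : FI (1 - ρ) f x = ∫ s in (0:ℝ)..x, (x - s) ^ (ρ - 1) * f s := by
      simp only [FI, smul_eq_mul, neg_sub]
    rw [e4, ← e3, ← e2]
  refine ⟨g, ?_, ⟨M, fun x hx => (Complex.abs_re_le_norm _).trans (GM x (ofReal_HD hx))⟩, ?_⟩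
  · intro x hx
    have a1 : AnalyticAt ℂ G x := Ghol.analyticAt ((HD_open R).mem_nhds (ofReal_HD hx))
    exact a1.re_ofReal
  · intro s hs
    have hcongr : EqOn f (fun x => ρ * Qr w t0 ρ x - lam * g x) (uIoc 0 s) := by
      intro x hx
      rw [uIoc_of_le hs.1.le] at hx
      exact fval x hx.1
    refine ⟨(fii s hs).congr hcongr, ?_⟩
    have e5 := (abel (ρ := 1 - ρ) (by linarith) (by linarith) hs.1 (fii s hs)).2
    have e6 : ∫ x in (0:ℝ)..s, (s - x) ^ (1 - ρ - 1) * FI (1 - ρ) f x = Bt (1 - ρ) * FI ρ g s := by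
      rw [FI, ← intervalIntegral.integral_const_mul]
      refine intervalIntegral.integral_congr_ae (Eventually.of_forall fun x hx => ?_)
      rw [uIoc_of_le hs.1.le] at hx
      rw [geq x ⟨hx.1, by linarith [hx.2, hs.2]⟩, smul_eq_mul]
      have : 1 - ρ - 1 = -ρ := by ring
      rw [this]; ring
    rw [e6] at e5
    have e7 := mul_left_cancel₀ hB.ne' e5
    rw [e7]
    exact intervalIntegral.integral_congr_ae (Eventually.of_forall fun x hx => hcongr hx)


lemma hist_cont {w : ℝ → ℝ} {t0 ρ : ℝ} (ht0 : 0 < t0) (h0 : 0 < ρ) (h1 : ρ < 1)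
    (wi : IntervalIntegrable w volume 0 t0) (wc : ContinuousOn w (Ioc 0 t0)) :
    ContinuousWithinAt (fun s => ∫ ξ in (0:ℝ)..t0, ((s - ξ) ^ (-ρ)) • w ξ) (Ici t0) t0 := by
  have hi := FI_ii (a := -ρ) (by linarith) ht0 wi wc
  refine intervalIntegral.continuousWithinAt_of_dominated_interval
    (bound := fun ξ => ‖((t0 - ξ) ^ (-ρ)) • w ξ‖) ?_ ?_ hi.norm ?_
  · filter_upwards [self_mem_nhdsWithin] with s hs
    have hs' : t0 ≤ s := hs
    rcases eq_or_lt_of_le hs' with h | h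
    · rw [← h]; exact hi.aestronglyMeasurable_restrict_uIoc
    · exact (ii_hist (a := -ρ) ht0.le h wi).aestronglyMeasurable_restrict_uIoc
  · filter_upwards [self_mem_nhdsWithin] with s hs
    have hs' : t0 ≤ s := hs
    have hae : ∀ᵐ ξ : ℝ, ξ ≠ t0 := by simp [ae_iff, measure_singleton]
    filter_upwards [hae] with ξ hne hξ
    rw [uIoc_of_le ht0.le] at hξ
    have hlt : ξ < t0 := lt_of_le_of_ne hξ.2 hne
    rw [norm_smul, norm_smul]
    refine mul_le_mul_of_nonneg_right ?_ (norm_nonneg _)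
    rw [Real.norm_eq_abs, Real.norm_eq_abs, abs_of_nonneg (Real.rpow_nonneg (by linarith) _),
      abs_of_nonneg (Real.rpow_nonneg (by linarith) _)]
    exact Real.rpow_le_rpow_of_nonpos (by linarith) (by linarith) (by linarith)
  · have hae : ∀ᵐ ξ : ℝ, ξ ≠ t0 := by simp [ae_iff, measure_singleton]
    filter_upwards [hae] with ξ hne hξ
    rw [uIoc_of_le ht0.le] at hξ
    have hlt : ξ < t0 := lt_of_le_of_ne hξ.2 hne
    have hk : ContinuousAt (fun s : ℝ => (s - ξ) ^ (-ρ)) t0 :=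
      ContinuousAt.rpow_const (by fun_prop) (Or.inl (by intro h; linarith))
    exact (hk.smul continuousAt_const).continuousWithinAt

lemma ext_sol {w : ℝ → ℝ} {t0 ρ T : ℝ} (lam : ℝ) (h0 : 0 < ρ) (h1 : ρ < 1) (ht0 : 0 < t0)
    (ht0T : t0 < T) (wi : IntervalIntegrable w volume 0 t0) (wc : ContinuousOn w (Ioc 0 t0)) :
    ∃ h : ℝ → ℝ, (∀ x ≤ t0, h x = w x) ∧ AnalyticOnNhd ℝ h (Ioo t0 T) ∧
      IntervalIntegrable h volume 0 T ∧
      ∀ s ∈ Ioo t0 T, IntervalIntegrable (fun ξ => ((s - ξ) ^ (-ρ)) • h ξ) volume 0 s ∧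
        FI ρ h s - FI ρ h t0 = -lam * ∫ x in t0..s, h x := by
  obtain ⟨g, gan, ⟨M, gM⟩, geq⟩ := ana (R := T - t0) lam ht0 h0 h1 (by linarith) wi wc
  set h : ℝ → ℝ := fun t => if t ≤ t0 then w t else g (t - t0) with hh
  have hl : ∀ x ≤ t0, h x = w x := fun x hx => by simp [hh, hx]
  have hr : ∀ x, t0 < x → h x = g (x - t0) := fun x hx => by simp [hh, not_le.2 hx]
  have gcont : ContinuousOn g (Ioo 0 (T - t0)) := gan.continuousOn
  have hcont : ContinuousOn h (Ioo t0 T) := by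
    have : ContinuousOn (fun x => g (x - t0)) (Ioo t0 T) :=
      gcont.comp (by fun_prop) (fun x hx => ⟨by linarith [hx.1], by linarith [hx.2]⟩)
    exact this.congr fun x hx => hr x hx.1
  have hbd : ∀ x ∈ Ioo t0 T, |h x| ≤ M := fun x hx => by
    rw [hr x hx.1]; exact gM _ ⟨by linarith [hx.1], by linarith [hx.2]⟩
  have hii : IntervalIntegrable h volume 0 T := by
    refine IntervalIntegrable.trans (b := t0) ?_ ?_
    · refine wi.congr fun x hx => ?_
      rw [uIoc_of_le ht0.le] at hx
      exact (hl x hx.2).symm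
    · rw [intervalIntegrable_iff_integrableOn_Ioo_of_le ht0T.le]
      refine Integrable.mono' (g := fun _ => M) (by simp) (hcont.aestronglyMeasurable measurableSet_Ioo) ?_
      filter_upwards [ae_restrict_mem measurableSet_Ioo] with x hx using hbd x hx
  refine ⟨h, hl, ?_, hii, ?_⟩
  · intro x hx
    have a1 : AnalyticAt ℝ (fun x => g (x - t0)) x := by
      refine AnalyticAt.fun_comp (gan _ ⟨by linarith [hx.1], by linarith [hx.2]⟩) ?_
      exact analyticAt_id.sub analyticAt_const
    refine a1.congr ?_
    filter_upwards [Ioi_mem_nhds hx.1] with y hy using (hr y hy).symm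
  · intro s hs
    have hs0 : s - t0 ∈ Ioo 0 (T - t0) := ⟨by linarith [hs.1], by linarith [hs.2]⟩
    obtain ⟨i0, e0⟩ := geq _ hs0
    have i1 : IntervalIntegrable (fun ξ => ((s - ξ) ^ (-ρ)) • h ξ) volume 0 t0 := by
      refine (ii_hist (a := -ρ) ht0.le hs.1 wi).congr fun x hx => ?_
      rw [uIoc_of_le ht0.le] at hx
      simp only [hl x hx.2]
    have i2 : IntervalIntegrable (fun ξ => ((s - ξ) ^ (-ρ)) • h ξ) volume t0 s := by
      have hb : IntervalIntegrable (fun ξ => (s - ξ) ^ (-ρ) * M) volume t0 s :=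
        (ii_rpow_right (by linarith) t0 s).mul_const M
      rw [intervalIntegrable_iff_integrableOn_Ioc_of_le hs.1.le] at hb ⊢
      refine Integrable.mono' hb ?_ ?_
      · have hk : Measurable (fun x : ℝ => (s - x) ^ (-ρ)) := by fun_prop
        refine hk.aestronglyMeasurable.smul ?_
        exact (hcont.mono fun x hx => ⟨hx.1, by linarith [hx.2, hs.2]⟩).aestronglyMeasurable measurableSet_Ioc
      · filter_upwards [ae_restrict_mem measurableSet_Ioc] with x hx
        have hn : 0 ≤ (s - x) ^ (-ρ) := Real.rpow_nonneg (by linarith [hx.2]) _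
        rw [norm_smul, Real.norm_eq_abs, abs_of_nonneg hn]
        exact mul_le_mul_of_nonneg_left (hbd x ⟨hx.1, by linarith [hx.2, hs.2]⟩) hn
    refine ⟨i1.trans i2, ?_⟩
    set Hf : ℝ → ℝ := fun s => ∫ ξ in (0:ℝ)..t0, ((s - ξ) ^ (-ρ)) • w ξ with hHf
    have hH : ∀ s, ∫ ξ in (0:ℝ)..t0, ((s - ξ) ^ (-ρ)) • h ξ = Hf s := by
      intro s
      refine intervalIntegral.integral_congr fun x hx => ?_
      rw [uIcc_of_le ht0.le] at hx
      simp only [hl x hx.2]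
    have hshift : ∀ k : ℝ → ℝ → ℝ, ∫ ξ in t0..s, k ξ (h ξ) = ∫ x in (0:ℝ)..(s - t0), k (x + t0) (g x) := by
      intro k
      have := intervalIntegral.integral_comp_sub_right (a := t0) (b := s) (fun x => k (x + t0) (g x)) t0
      rw [sub_self] at this
      rw [← this]
      refine intervalIntegral.integral_congr_ae (Eventually.of_forall fun x hx => ?_)
      rw [uIoc_of_le hs.1.le] at hx
      simp only [sub_add_cancel]
      rw [hr x hx.1]
    have e1 : FI ρ h s = Hf s + FI ρ g (s - t0) := by
      rw [FI, ← intervalIntegral.integral_add_adjacent_intervals i1 i2, hH s,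
        hshift (fun ξ y => (s - ξ) ^ (-ρ) • y), FI]
      congr 1
      refine intervalIntegral.integral_congr fun x _ => ?_
      have : s - (x + t0) = s - t0 - x := by ring
      simp only [this]
    have e2 : FI ρ h t0 = Hf t0 := hH t0
    have e3 : ∫ x in t0..s, h x = ∫ x in (0:ℝ)..(s - t0), g x := hshift (fun _ y => y)
    -- integrability of Qr
    have gii : IntervalIntegrable g volume 0 (s - t0) := by
      rw [intervalIntegrable_iff_integrableOn_Ioc_of_le hs0.1.le]
      refine Integrable.mono' (g := fun _ => M) (by simp)
        ((gcont.mono fun x hx => ⟨hx.1, by linarith [hx.2, hs0.2]⟩).aestronglyMeasurable measurableSet_Ioc) ?_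
      filter_upwards [ae_restrict_mem measurableSet_Ioc] with x hx
      exact gM x ⟨hx.1, by linarith [hx.2, hs0.2]⟩
    have qii : IntervalIntegrable (fun x => ρ * Qr w t0 ρ x) volume 0 (s - t0) := by
      have := i0.add (gii.const_mul lam)
      refine this.congr fun x _ => ?_
      simp
    have e4 : FI ρ g (s - t0) = (∫ x in (0:ℝ)..(s - t0), ρ * Qr w t0 ρ x)
        - lam * ∫ x in (0:ℝ)..(s - t0), g x := by
      rw [e0, intervalIntegral.integral_sub qii (gii.const_mul lam), intervalIntegral.integral_const_mul lam]
    have e5 : ∫ x in (0:ℝ)..(s - t0), -(ρ * Qr w t0 ρ x) = Hf (t0 + (s - t0)) - Hf (t0 + 0) := by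
      refine intervalIntegral.integral_eq_sub_of_hasDerivAt_of_le (f := fun x => Hf (t0 + x)) hs0.1.le ?_ ?_ qii.neg
      · intro x hx
        rcases eq_or_lt_of_le hx.1 with hx0 | hx0
        · rw [← hx0]
          have hc := hist_cont ht0 h0 h1 wi wc
          refine ContinuousWithinAt.comp (t := Ici t0) (g := Hf) (f := fun x => t0 + x) ?_ (by fun_prop) ?_
          · rw [add_zero]; exact hc
          · intro y hy; simpa using hy.1
        · have := hist_deriv (a := -ρ) ht0.le (by linarith : t0 < t0 + x) wi
          exact (ContinuousAt.comp (g := Hf) (f := fun x => t0 + x) this.continuousAt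
            (by fun_prop)).continuousWithinAt
      · intro x hx
        have := hist_deriv (a := -ρ) ht0.le (by linarith [hx.1] : t0 < t0 + x) wi
        have h2 := this.comp_const_add t0 x
        refine h2.congr_deriv ?_
        rw [Qr, ← neg_mul, ← intervalIntegral.integral_const_mul]
        congr 1; ext ξ
        simp only [smul_eq_mul]; ring
    rw [intervalIntegral.integral_neg] at e5
    have c1 : t0 + (s - t0) = s := by ring
    rw [c1, add_zero] at e5
    rw [e1, e2, e3, e4]
    linarith


lemma FI_congr {ρ : ℝ} {w h : ℝ → ℝ} {s : ℝ} (hs : 0 ≤ s) (hz : ∀ x ∈ Ioc 0 s, w x = h x) :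
    FI ρ w s = FI ρ h s := by
  rw [FI, FI]
  refine intervalIntegral.integral_congr_ae (Eventually.of_forall fun ξ hξ => ?_)
  rw [uIoc_of_le hs] at hξ
  rw [hz ξ hξ]

lemma key {ρ lam T : ℝ} (h0 : 0 < ρ) (h1 : ρ < 1) (hl : 0 < lam) {w : ℝ → ℝ}
    (hw : Sol ρ lam T w) {t0 : ℝ} (ht0 : t0 ∈ Ioo 0 T) (hne : w t0 ≠ 0) :
    ∀ s ∈ Ico t0 T, FI ρ w s - FI ρ w t0 = -lam * ∫ x in t0..s, w x := by
  obtain ⟨h, hl0, han, hi, hJ⟩ := ext_sol lam h0 h1 ht0.1 ht0.2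
    (ii_sub hw.ii le_rfl ht0.1.le ht0.2.le)
    (hw.cont.mono fun x hx => ⟨hx.1, by linarith [hx.2, ht0.2]⟩)
  have ht : 0 < t0 := ht0.1
  have htT : t0 < T := ht0.2
  have hJ0 : ∀ s, t0 ≤ s → s < T → FI ρ h s - FI ρ h t0 = -lam * ∫ x in t0..s, h x := by
    intro s hs hsT
    rcases eq_or_lt_of_le hs with e | e
    · rw [← e]; simp
    · exact (hJ s ⟨e, hsT⟩).2
  have hJ' : ∀ s1 s2, t0 ≤ s1 → s1 ≤ s2 → s2 < T →
      FI ρ h s2 - FI ρ h s1 = -lam * ∫ x in s1..s2, h x := by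
    intro s1 s2 a b d
    have e1 := hJ0 s1 a (by linarith)
    have e2 := hJ0 s2 (by linarith) d
    have e3 := intervalIntegral.integral_add_adjacent_intervals
      (ii_sub hi ht.le a (by linarith)) (ii_sub hi (by linarith) b d.le)
    linear_combination e2 - e1 + lam * e3
  have D : ∀ c b, t0 ≤ c → c < b → b ≤ T → (∀ x ∈ Ioc 0 c, w x = h x) →
      (∀ x ∈ Ioo c b, w x ≠ 0) → ∀ x ∈ Ioo c b, w x = h x := by
    intro c b hc hcb hbT heq hn
    have yi : IntervalIntegrable (fun x => w x - h x) volume 0 b :=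
      ii_sub (hw.ii.sub hi) le_rfl (by linarith) hbT
    have z0 : ∀ x ∈ Ioc 0 c, w x - h x = 0 := fun x hx => sub_eq_zero.2 (heq x hx)
    have fin := uniq_at (lam := lam) (b := b) (c := c) h0 h1 (by linarith) hcb.le yi
      ((hw.cont.mono fun x hx => ⟨by linarith [hx.1], by linarith [hx.2]⟩).sub
        (han.continuousOn.mono fun x hx => ⟨by linarith [hx.1], by linarith [hx.2]⟩)) z0 (by
      intro s hs
      have hsT : s < T := by linarith [hs.2]
      have e0 : FI ρ (fun x => w x - h x) s = FI ρ w s - FI ρ h s := by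
        rw [FI, FI, FI, ← intervalIntegral.integral_sub]
        · simp only [smul_sub]
        · exact FI_ii (by linarith) (by linarith [hs.1]) (ii_sub hw.ii le_rfl (by linarith [hs.1]) hsT.le)
            (hw.cont.mono fun x hx => ⟨hx.1, by linarith [hx.2]⟩)
        · exact (hJ s ⟨by linarith [hs.1], hsT⟩).1
      rw [e0, intervalIntegral.integral_sub (ii_sub hw.ii (by linarith) hs.1.le hsT.le)
        (ii_sub hi (by linarith) hs.1.le hsT.le)]
      have e1 := hw.incr h1 (by linarith : 0 < c) hs.1.le hsT
        (fun x hx => hn x ⟨hx.1, by linarith [hx.2, hs.2]⟩)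
      have e2 := hJ' c s hc hs.1.le hsT
      have e3 : FI ρ w c = FI ρ h c := FI_congr (by linarith) heq
      linear_combination e1 - e2 + e3)
    intro x hx
    exact sub_eq_zero.1 (fin x hx)
  have N : ∀ c, t0 ≤ c → c < T → w c ≠ 0 → ∃ b, c < b ∧ b ≤ T ∧ ∀ x ∈ Ioo c b, w x ≠ 0 := by
    intro c hc hcT hn
    have hcat : ContinuousAt w c := hw.cont.continuousAt (Ioo_mem_nhds (by linarith) hcT)
    obtain ⟨l, hl1, hl2⟩ := mem_nhdsGE_iff_exists_Ico_subset.1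
      ((hcat.eventually_ne hn).filter_mono nhdsWithin_le_nhds : ∀ᶠ x in 𝓝[≥] c, w x ≠ 0)
    exact ⟨min l T, lt_min hl1 hcT, min_le_right _ _,
      fun x hx => hl2 ⟨hx.1.le, hx.2.trans_le (min_le_left _ _)⟩⟩
  have hbase : ∀ x ∈ Ioc 0 t0, w x = h x := fun x hx => (hl0 x hx.2).symm
  obtain ⟨b0, hb0, hb0T, hb0n⟩ := N t0 le_rfl htT hne
  have hE0 := D t0 b0 le_rfl hb0 hb0T hbase hb0n
  have hcont : ContinuousOn h (Ioo 0 T) := by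
    intro x hx
    refine ContinuousAt.continuousWithinAt ?_
    rcases le_or_gt x t0 with k | k
    · have hcat : ContinuousAt w x := hw.cont.continuousAt (Ioo_mem_nhds hx.1 hx.2)
      refine hcat.congr ?_
      filter_upwards [Ioo_mem_nhds hx.1 (by linarith : x < b0)] with y hy
      rcases le_or_gt y t0 with k' | k'
      · exact hbase y ⟨hy.1, k'⟩
      · exact hE0 y ⟨k', hy.2⟩
    · exact (han x ⟨k, hx.2⟩).continuousAt
  have hstep : ∀ c, t0 ≤ c → c < T → (∀ x ∈ Ioc 0 c, w x = h x) →
      ∃ e, c < e ∧ ∀ x ∈ Ioo c e, w x = h x := by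
    intro c hc hcT heq
    by_cases hwc : w c = 0
    · have hcne : t0 < c := lt_of_le_of_ne hc (by rintro rfl; exact hne hwc)
      have hhc : h c = 0 := by rw [← heq c ⟨by linarith, le_rfl⟩]; exact hwc
      have hd : AnalyticOnNhd ℝ (deriv h) (Ioo t0 T) := han.deriv
      rcases (hd c ⟨hcne, hcT⟩).eventually_eq_zero_or_eventually_ne_zero with hz | hz
      · exfalso
        have hz' : EqOn (deriv h) 0 (Ioo t0 T) :=
          hd.eqOn_zero_of_preconnected_of_eventuallyEq_zero isPreconnected_Ioo ⟨hcne, hcT⟩ hz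
        obtain ⟨k, hk⟩ := isOpen_Ioo.exists_is_const_of_deriv_eq_zero isPreconnected_Ioo
          (fun x hx => (han x hx).differentiableAt.differentiableWithinAt) hz'
        have m : (t0 + b0) / 2 ∈ Ioo t0 b0 := ⟨by linarith, by linarith⟩
        have m1 := hk ((t0 + b0) / 2) ⟨m.1, by linarith [m.2]⟩
        have m2 := hk c ⟨hcne, hcT⟩
        have m3 := hb0n _ m
        rw [hE0 _ m] at m3
        apply m3
        rw [m1, ← m2, hhc]
      · have hz2 : ∀ᶠ z in 𝓝[>] c, deriv h z ≠ 0 :=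
          hz.filter_mono (nhdsWithin_mono _ (fun x (hx : c < x) => hx.ne'))
        obtain ⟨l, hl1, hl2⟩ := mem_nhdsGT_iff_exists_Ioo_subset.1 hz2
        have hce : c < min l T := lt_min hl1 hcT
        have heT : min l T ≤ T := min_le_right _ _
        refine ⟨min l T, hce, ?_⟩
        have hdn : ∀ x ∈ Ioo c (min l T), deriv h x ≠ 0 :=
          fun x hx => hl2 ⟨hx.1, hx.2.trans_le (min_le_left _ _)⟩
        have hcI : ContinuousOn h (Ico c (min l T)) :=
          hcont.mono fun x hx => ⟨by linarith [hx.1], by linarith [hx.2]⟩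
        have hdar := hasDerivWithinAt_forall_lt_or_forall_gt_of_forall_ne (m := 0)
          (convex_Ioo c (min l T)) (f := h) (f' := deriv h)
          (fun x hx => ((han x ⟨by linarith [hx.1], by linarith [hx.2]⟩).differentiableAt.hasDerivAt).hasDerivWithinAt)
          hdn
        rcases hdar with hd1 | hd1
        · have hanti : StrictAntiOn h (Ico c (min l T)) :=
            strictAntiOn_of_deriv_neg (convex_Ico _ _) hcI (by rw [interior_Ico]; exact hd1)
          exact step h0 h1 hl hw hi hcont (by linarith) hce heT heq hhc hanti
            (fun s1 s2 a b d => hJ' s1 s2 (by linarith) b (by linarith))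
        · have hmon : StrictMonoOn h (Ico c (min l T)) :=
            strictMonoOn_of_deriv_pos (convex_Ico _ _) hcI (by rw [interior_Ico]; exact hd1)
          have := step h0 h1 hl hw.neg (h := fun x => - h x) hi.neg hcont.neg (by linarith) hce heT
            (fun x hx => by rw [heq x hx]) (by simp [hhc])
            (fun x hx y hy hxy => neg_lt_neg (hmon hx hy hxy))
            (fun s1 s2 a b d => by
              rw [FI_neg, intervalIntegral.integral_neg]
              have := hJ' s1 s2 (by linarith) b (by linarith)
              simp only
              linear_combination -this)
          intro x hx
          exact neg_injective (this x hx)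
    · obtain ⟨b, hb, hbT, hbn⟩ := N c hc hcT hwc
      exact ⟨b, hb, D c b hc hb hbT heq hbn⟩
  have all : ∀ s, t0 ≤ s → s < T → w s = h s := by
    by_contra hcon
    push Not at hcon
    obtain ⟨s, hs, hsT, hsn⟩ := hcon
    set B : Set ℝ := {x | t0 ≤ x ∧ x < T ∧ w x ≠ h x} with hB
    have hBb : BddBelow B := ⟨t0, fun x hx => hx.1⟩
    have hBn : B.Nonempty := ⟨s, hs, hsT, hsn⟩
    set c := sInf B with hc
    have c1 : t0 ≤ c := le_csInf hBn fun x hx => hx.1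
    have c2 : c ≤ s := csInf_le hBb ⟨hs, hsT, hsn⟩
    have c3 : ∀ x, 0 < x → x < c → w x = h x := by
      intro x hx hxc
      rcases le_or_gt x t0 with k | k
      · exact hbase x ⟨hx, k⟩
      · by_contra hn
        have : c ≤ x := csInf_le hBb ⟨k.le, by linarith, hn⟩
        linarith
    have c4 : w c = h c := by
      rcases eq_or_lt_of_le c1 with k | k
      · rw [← k]; exact hbase t0 ⟨ht, le_rfl⟩
      · have hat : ContinuousAt (fun x => w x - h x) c :=
          (hw.cont.sub hcont).continuousAt (Ioo_mem_nhds (by linarith) (by linarith))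
        by_contra hn
        have hev := (hat.eventually_ne (sub_ne_zero.2 hn)).filter_mono (nhdsWithin_le_nhds (s := Iio c))
        have hev2 : ∀ᶠ x in 𝓝[<] c, x ∈ Ioo t0 c := Ioo_mem_nhdsLT k
        obtain ⟨x, hx1, hx2⟩ := (hev.and hev2).exists
        exact hx1 (sub_eq_zero.2 (c3 x (by linarith [hx2.1]) hx2.2))
    obtain ⟨e, he, heq⟩ := hstep c c1 (by linarith) (fun x hx => by
      rcases eq_or_lt_of_le hx.2 with k | k
      · rw [k]; exact c4
      · exact c3 x hx.1 k)
    obtain ⟨x, hx, hxe⟩ := exists_lt_of_csInf_lt hBn he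
    have hcx : c ≤ x := csInf_le hBb hx
    rcases eq_or_lt_of_le hcx with k | k
    · exact hx.2.2 (k ▸ c4)
    · exact hx.2.2 (heq x ⟨k, hxe⟩)
  have all' : ∀ s, 0 < s → s < T → w s = h s := by
    intro s hs hsT
    rcases le_or_gt s t0 with k | k
    · exact hbase s ⟨hs, k⟩
    · exact all s k.le hsT
  intro s hs
  rw [FI_congr (by linarith [hs.1]) (fun x hx => all' x hx.1 (by linarith [hx.2, hs.2])),
    FI_congr ht.le (fun x hx => all' x hx.1 (by linarith [hx.2])), hJ' t0 s le_rfl hs.1 hs.2]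
  congr 1
  refine intervalIntegral.integral_congr fun x hx => ?_
  rw [uIcc_of_le hs.1] at hx
  exact (all' x (by linarith [hx.1]) (by linarith [hx.2, hs.2])).symm

lemma scal {ρ lam T : ℝ} (h0 : 0 < ρ) (h1 : ρ < 1) (hl : 0 < lam) {w : ℝ → ℝ}
    (hw : Sol ρ lam T w) {s1 s2 : ℝ} (hs1 : 0 < s1) (hs : s1 ≤ s2) (hs2 : s2 < T) :
    FI ρ w s2 - FI ρ w s1 = -lam * ∫ x in s1..s2, w x := by
  have K : ∀ t0 s, 0 < t0 → w t0 ≠ 0 → t0 ≤ s → s ≤ s2 →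
      FI ρ w s2 - FI ρ w s = -lam * ∫ x in s..s2, w x := by
    intro t0 s ht0 hn hs0 hs3
    have k := key h0 h1 hl hw (t0 := t0) ⟨ht0, by linarith⟩ hn
    have e1 := k s ⟨hs0, by linarith⟩
    have e2 := k s2 ⟨by linarith, hs2⟩
    have e3 := intervalIntegral.integral_add_adjacent_intervals
      (ii_sub hw.ii ht0.le hs0 (by linarith)) (ii_sub hw.ii (by linarith) hs3 hs2.le)
    linear_combination e2 - e1 + lam * e3
  by_cases hA : ∃ t0, 0 < t0 ∧ t0 ≤ s1 ∧ w t0 ≠ 0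
  · obtain ⟨t0, a, b, c⟩ := hA
    exact K t0 s1 a c b hs
  push Not at hA
  by_cases hB0 : ∃ x, s1 ≤ x ∧ x ≤ s2 ∧ w x ≠ 0
  swap
  · push Not at hB0
    have z : ∀ x ∈ Ioc 0 s2, w x = 0 := fun x hx => by
      rcases le_or_gt x s1 with k | k
      · exact hA x hx.1 k
      · exact hB0 x k.le hx.2
    rw [FI_zero (by linarith) z, FI_zero hs1.le (fun x hx => z x ⟨hx.1, hx.2.trans hs⟩),
      intervalIntegral.integral_congr (g := fun _ => (0:ℝ))]
    · simp
    · intro x hx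
      rw [uIcc_of_le hs] at hx
      exact z x ⟨by linarith [hx.1], hx.2⟩
  · set B : Set ℝ := {x | s1 ≤ x ∧ x ≤ s2 ∧ w x ≠ 0} with hB
    have hBb : BddBelow B := ⟨s1, fun x hx => hx.1⟩
    have hBn : B.Nonempty := hB0
    set a := sInf B with ha
    have a1 : s1 ≤ a := le_csInf hBn fun x hx => hx.1
    obtain ⟨x0, hx0⟩ := hB0
    have a2 : a ≤ s2 := (csInf_le hBb hx0).trans hx0.2.1
    have z : ∀ x, 0 < x → x < a → w x = 0 := by
      intro x hx hxa
      rcases le_or_gt x s1 with k | k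
      · exact hA x hx k
      · by_contra hn
        have : a ≤ x := csInf_le hBb ⟨k.le, by linarith, hn⟩
        linarith
    have za : w a = 0 := by
      rcases eq_or_lt_of_le a1 with k | k
      · rw [← k]; exact hA s1 hs1 le_rfl
      · have hat : ContinuousAt w a := hw.cont.continuousAt (Ioo_mem_nhds (by linarith) (by linarith))
        by_contra hn
        have hev := (hat.eventually_ne hn).filter_mono (nhdsWithin_le_nhds (s := Iio a))
        have hev2 : ∀ᶠ x in 𝓝[<] a, x ∈ Ioo s1 a := Ioo_mem_nhdsLT k
        obtain ⟨x, hx1, hx2⟩ := (hev.and hev2).exists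
        exact hx1 (z x (by linarith [hx2.1]) hx2.2)
    have z' : ∀ x ∈ Ioc 0 a, w x = 0 := fun x hx => by
      rcases eq_or_lt_of_le hx.2 with k | k
      · rw [k]; exact za
      · exact z x hx.1 k
    set G : ℝ → ℝ := fun t => FI ρ w s2 - FI ρ w t + lam * ∫ x in t..s2, w x with hG
    have Gc : ContinuousOn G (Icc s1 s2) := by
      have c1 : ContinuousOn (FI ρ w) (Icc s1 s2) :=
        (FI_cont h1 hw.ii hw.cont).mono fun x hx => ⟨by linarith [hx.1], by linarith [hx.2]⟩
      have c2 : ContinuousOn (fun t => ∫ x in t..s2, w x) (Icc s1 s2) := by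
        have i := ii_sub hw.ii hs1.le hs hs2.le
        have := intervalIntegral.continuousOn_primitive_interval_left (f := w) (μ := volume)
          (a := s1) (b := s2) (by rw [uIcc_of_le hs]; exact (intervalIntegrable_iff_integrableOn_Icc_of_le hs).1 i)
        rwa [uIcc_of_le hs] at this
      exact (continuousOn_const.sub c1).add (c2.const_smul lam)
    have hcl : IsClosed (Icc s1 s2 ∩ G ⁻¹' {0}) :=
      Gc.preimage_isClosed_of_isClosed isClosed_Icc isClosed_singleton
    have hBG : B ⊆ Icc s1 s2 ∩ G ⁻¹' {0} := by
      intro x hx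
      refine ⟨⟨hx.1, hx.2.1⟩, ?_⟩
      have := K x x (by linarith [hx.1]) hx.2.2 le_rfl hx.2.1
      simp only [hG, mem_preimage, mem_singleton_iff]
      linarith
    have haG := closure_minimal hBG hcl (csInf_mem_closure hBn hBb)
    have ga : FI ρ w s2 - FI ρ w a + lam * ∫ x in a..s2, w x = 0 := haG.2
    rw [FI_zero (by linarith) z'] at ga
    have e3 := intervalIntegral.integral_add_adjacent_intervals
      (ii_sub hw.ii hs1.le a1 (by linarith)) (ii_sub hw.ii (by linarith) a2 hs2.le)
    have e4 : ∫ x in s1..a, w x = 0 := by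
      rw [intervalIntegral.integral_congr (g := fun _ => (0:ℝ))]
      · simp
      · intro x hx
        rw [uIcc_of_le a1] at hx
        exact z' x ⟨by linarith [hx.1], hx.2⟩
    rw [FI_zero hs1.le (fun x hx => hA x hx.1 hx.2)]
    linear_combination ga - lam * e3 + lam * e4

lemma scal_uniq {ρ lam T : ℝ} (h0 : 0 < ρ) (h1 : ρ < 1) (hl : 0 < lam) {w1 w2 : ℝ → ℝ}
    (hw1 : Sol ρ lam T w1) (hw2 : Sol ρ lam T w2) {p : ℝ}
    (l1 : Tendsto (FI ρ w1) (𝓝[>] 0) (𝓝 p)) (l2 : Tendsto (FI ρ w2) (𝓝[>] 0) (𝓝 p)) :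
    ∀ s ∈ Ioo 0 T, w1 s = w2 s := by
  have G : ∀ w, Sol ρ lam T w → Tendsto (FI ρ w) (𝓝[>] 0) (𝓝 p) → ∀ s ∈ Ioo 0 T,
      FI ρ w s - p = -lam * ∫ x in (0:ℝ)..s, w x := by
    intro w hw hp s hs
    have t1 : Tendsto (fun t => FI ρ w s - FI ρ w t) (𝓝[>] 0) (𝓝 (FI ρ w s - p)) :=
      tendsto_const_nhds.sub hp
    have hc : ContinuousOn (fun t => ∫ x in t..s, w x) (Icc 0 s) := by
      have i := ii_sub hw.ii le_rfl hs.1.le hs.2.le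
      have := intervalIntegral.continuousOn_primitive_interval_left (f := w) (μ := volume)
        (a := 0) (b := s) (by rw [uIcc_of_le hs.1.le]; exact (intervalIntegrable_iff_integrableOn_Icc_of_le hs.1.le).1 i)
      rwa [uIcc_of_le hs.1.le] at this
    have t2 : Tendsto (fun t => ∫ x in t..s, w x) (𝓝[>] 0) (𝓝 (∫ x in (0:ℝ)..s, w x)) := by
      have h3 := hc 0 ⟨le_rfl, hs.1.le⟩
      refine h3.mono_left ?_
      rw [← nhdsWithin_Ioo_eq_nhdsGT hs.1]
      exact nhdsWithin_mono _ Ioo_subset_Icc_self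
    refine tendsto_nhds_unique t1 ((t2.const_mul (-lam)).congr' ?_)
    filter_upwards [Ioo_mem_nhdsGT hs.1] with t ht
    exact (scal h0 h1 hl hw ht.1 ht.2.le hs.2).symm
  have fin := uniq (lam := lam) (b := T) (c := 0) (y := fun x => w1 x - w2 x) h0 h1 le_rfl
    (hw1.ii.sub hw2.ii) (hw1.cont.sub hw2.cont) (by
      intro s hs
      rw [FI_sub h1 hs hw1.ii hw1.cont hw2.ii hw2.cont, intervalIntegral.integral_sub
        (ii_sub hw1.ii le_rfl hs.1.le hs.2.le) (ii_sub hw2.ii le_rfl hs.1.le hs.2.le)]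
      linear_combination G w1 hw1 l1 s hs - G w2 hw2 l2 s hs)
  exact fun s hs => sub_eq_zero.1 (fin s hs)


section
variable {H : Type*} [NormedAddCommGroup H] [InnerProductSpace ℝ H] [CompleteSpace H]

lemma Aop_inner (v : HilbertBasis ℕ ℝ H) (lam : ℕ → ℝ) (x : H)
    (hs : Summable (fun k : ℕ => (lam k) ^ 2 * ⟪x, v k⟫ ^ 2)) (k : ℕ) :
    ⟪∑' k : ℕ, (lam k * ⟪x, v k⟫) • v k, v k⟫ = lam k * ⟪x, v k⟫ := by
  have hm : Memℓp (fun k : ℕ => lam k * ⟪x, v k⟫) 2 := by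
    refine memℓp_gen (hs.congr fun k => ?_)
    simp [mul_pow]
  set f : lp (fun _ : ℕ => ℝ) 2 := ⟨fun k : ℕ => lam k * ⟪x, v k⟫, hm⟩ with hf
  have h1 := v.hasSum_repr_symm f
  have h2 : ∑' k : ℕ, (lam k * ⟪x, v k⟫) • v k = v.repr.symm f := h1.tsum_eq
  rw [h2, real_inner_comm, ← v.repr_apply_apply, LinearIsometryEquiv.apply_symm_apply]

lemma norm_est (v : HilbertBasis ℕ ℝ H) (lam : ℕ → ℝ) (hlam1 : 0 < lam 0) (hmono : Monotone lam)
    {x y : H} (h : ∀ k, ⟪y, v k⟫ = lam k * ⟪x, v k⟫) : lam 0 * ‖x‖ ≤ ‖y‖ := by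
  have hx := (v.hasSum_inner_mul_inner x x).mul_left ((lam 0) ^ 2)
  have hy := v.hasSum_inner_mul_inner y y
  have := hasSum_le (fun k => ?_) hx hy
  · rw [real_inner_self_eq_norm_sq, real_inner_self_eq_norm_sq, ← mul_pow] at this
    exact le_of_sq_le_sq this (norm_nonneg _)
  · rw [real_inner_comm x (v k), real_inner_comm y (v k), h k]
    have h0 : lam 0 ≤ lam k := hmono (Nat.zero_le k)
    have h2 : lam 0 ^ 2 ≤ lam k ^ 2 := by gcongr
    nlinarith [mul_self_nonneg ⟪x, v k⟫]

lemma comp_zero (v : HilbertBasis ℕ ℝ H) {x : H} (h : ∀ k, ⟪x, v k⟫ = 0) : x = 0 := by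
  have := norm_est v (fun _ => 1) one_pos monotone_const (x := x) (y := 0) (by simp [h])
  simpa using this

lemma FI_rl {ρ : ℝ} (h1 : ρ < 1) (u : ℝ → H) :
    FI ρ u = fun s => Real.Gamma (1 - ρ) • rlIntegral (1 - ρ) u s := by
  ext s
  have hg : Real.Gamma (1 - ρ) ≠ 0 := (Real.Gamma_pos_of_pos (by linarith)).ne'
  have e : 1 - ρ - 1 = -ρ := by ring
  rw [rlIntegral, smul_smul, mul_one_div_cancel hg, one_smul, FI, e]

lemma vec_sol (v : HilbertBasis ℕ ℝ H) (lam : ℕ → ℝ) (hlam1 : 0 < lam 0) (hmono : Monotone lam)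
    {ρ : ℝ} (h1 : ρ < 1) {T : ℝ} (hT : 0 < T) (Aop : H → H)
    (hA : Aop = fun h : H => ∑' k : ℕ, (lam k * ⟪h, v k⟫) • v k)
    (u : ℝ → H)
    (hdom : ∀ t ∈ Ioc (0 : ℝ) T, Summable (fun k : ℕ => (lam k) ^ 2 * ⟪u t, v k⟫ ^ 2))
    (hAcont : ContinuousOn (fun t : ℝ => Aop (u t)) (Ioc (0 : ℝ) T))
    (heq : ∀ t ∈ Ioc (0 : ℝ) T, rlDeriv ρ u t + Aop (u t) = 0) :
    ContinuousOn u (Ioc 0 T) ∧ ∀ k, Sol ρ (lam k * Real.Gamma (1 - ρ)) T (fun t => ⟪u t, v k⟫) ∧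
      ∀ s ∈ Ioo 0 T, FI ρ (fun t => ⟪u t, v k⟫) s = ⟪FI ρ u s, v k⟫ := by
  have hg : 0 < Real.Gamma (1 - ρ) := Real.Gamma_pos_of_pos (by linarith)
  have hin : ∀ t ∈ Ioc 0 T, ∀ k, ⟪Aop (u t), v k⟫ = lam k * ⟪u t, v k⟫ := by
    intro t ht k; rw [hA]; exact Aop_inner v lam (u t) (hdom t ht) k
  have hA0 : ∀ t ∈ Ioc 0 T, Aop (u t) = 0 → u t = 0 := by
    intro t ht h0
    have := norm_est v lam hlam1 hmono (hin t ht)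
    rw [h0, norm_zero] at this
    have hn := norm_nonneg (u t)
    exact norm_eq_zero.1 (le_antisymm (by nlinarith) hn)
  have uc : ContinuousOn u (Ioc 0 T) := by
    intro t ht
    have hc := hAcont t ht
    rw [ContinuousWithinAt, tendsto_iff_norm_sub_tendsto_zero] at hc ⊢
    have hc2 := hc.const_mul (lam 0)⁻¹
    rw [mul_zero] at hc2
    refine squeeze_zero' (Eventually.of_forall fun s => norm_nonneg _) ?_ hc2
    filter_upwards [self_mem_nhdsWithin] with s hs
    have := norm_est v lam hlam1 hmono (x := u s - u t) (y := Aop (u s) - Aop (u t)) (fun k => by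
      rw [inner_sub_left, inner_sub_left, hin s hs, hin t ht]; ring)
    rw [inv_mul_eq_div, le_div_iff₀ hlam1]; linarith
  have ucoo : ContinuousOn u (Ioo 0 T) := uc.mono Ioo_subset_Ioc_self
  have ui : IntervalIntegrable u volume 0 T := by
    by_contra hni
    have hF : ∀ s ∈ Ioo 0 T, FI ρ u s = 0 := by
      intro s hs
      refine intervalIntegral.integral_undef fun hii => hni ?_
      refine IntervalIntegrable.trans (b := s / 2) ?_ ?_
      · have i1 := ii_sub hii le_rfl (by linarith [hs.1] : 0 ≤ s / 2) (by linarith [hs.1])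
        have i2 : IntervalIntegrable (fun ξ => ((s - ξ) ^ ρ) • ((s - ξ) ^ (-ρ)) • u ξ) volume 0 (s / 2) := by
          refine i1.continuousOn_smul ?_
          rw [uIcc_of_le (by linarith [hs.1])]
          refine ContinuousOn.rpow_const (by fun_prop) ?_
          intro x hx; left; have := hx.2; intro h0; linarith [hs.1]
        refine i2.congr fun x hx => ?_
        rw [uIoc_of_le (by linarith [hs.1])] at hx
        have hp : 0 < s - x := by linarith [hx.2, hs.1]
        simp only [smul_smul]
        rw [← Real.rpow_add hp, add_neg_cancel, Real.rpow_zero, one_smul]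
      · refine ContinuousOn.intervalIntegrable ?_
        rw [uIcc_of_le (by linarith [hs.1, hs.2])]
        exact uc.mono fun x hx => ⟨by linarith [hx.1, hs.1], hx.2⟩
    have hu : ∀ s ∈ Ioo 0 T, u s = 0 := by
      intro s hs
      have hs' : s ∈ Ioc 0 T := ⟨hs.1, hs.2.le⟩
      have hd : deriv (rlIntegral (1 - ρ) u) s = 0 := by
        have : rlIntegral (1 - ρ) u =ᶠ[𝓝 s] fun _ => 0 := by
          filter_upwards [Ioo_mem_nhds hs.1 hs.2] with x hx
          have := hF x hx
          rw [FI_rl h1] at this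
          exact (smul_eq_zero.1 this).resolve_left hg.ne'
        rw [this.deriv_eq]; simp
      have := heq s hs'
      rw [rlDeriv, hd, zero_add] at this
      exact hA0 s hs' this
    refine hni ?_
    rw [intervalIntegrable_iff_integrableOn_Ioo_of_le hT.le]
    exact integrableOn_zero.congr_fun (fun x hx => (hu x hx).symm) measurableSet_Ioo
  refine ⟨uc, fun k => ?_⟩
  set w : ℝ → ℝ := fun t => ⟪u t, v k⟫ with hw
  have hFI : ∀ s ∈ Ioo 0 T, FI ρ w s = ⟪FI ρ u s, v k⟫ := by
    intro s hs
    have i := FI_ii (a := -ρ) (by linarith) hs.1 (ii_sub ui le_rfl hs.1.le hs.2.le)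
      (ucoo.mono fun x hx => ⟨hx.1, by linarith [hx.2, hs.2]⟩)
    have := (innerSL ℝ (v k)).intervalIntegral_comp_comm i
    rw [real_inner_comm, FI, FI]
    simp only [innerSL_apply_apply] at this
    rw [← this]
    refine intervalIntegral.integral_congr fun x _ => ?_
    simp only [hw]
    rw [inner_smul_right, real_inner_comm, smul_eq_mul]
  have Dv : ∀ s ∈ Ioo 0 T, DifferentiableAt ℝ (FI ρ u) s →
      HasDerivAt (FI ρ w) (-(lam k * Real.Gamma (1 - ρ)) * w s) s := by
    intro s hs hd
    have hs' : s ∈ Ioc 0 T := ⟨hs.1, hs.2.le⟩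
    have hd1 : deriv (FI ρ u) s = Real.Gamma (1 - ρ) • (-(Aop (u s))) := by
      rw [FI_rl h1, deriv_fun_const_smul_field]
      congr 1
      exact eq_neg_of_add_eq_zero_left (heq s hs')
    have hd2 := hd.hasDerivAt
    rw [hd1] at hd2
    have hd3 := hd2.inner ℝ (hasDerivAt_const s (v k))
    refine (hd3.congr_of_eventuallyEq ?_).congr_deriv ?_
    · filter_upwards [Ioo_mem_nhds hs.1 hs.2] with x hx using hFI x hx
    · rw [inner_zero_right, zero_add, inner_smul_left, inner_neg_left, hin s hs']
      simp only [hw]; simp; ring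
  have dif : ∀ s ∈ Ioo 0 T, u s ≠ 0 → DifferentiableAt ℝ (FI ρ u) s := by
    intro s hs hne
    have hs' : s ∈ Ioc 0 T := ⟨hs.1, hs.2.le⟩
    rw [FI_rl h1]
    refine DifferentiableAt.fun_const_smul ?_ _
    refine differentiableAt_of_deriv_ne_zero fun h0 => hne (hA0 s hs' ?_)
    have := heq s hs'
    rwa [rlDeriv, h0, zero_add] at this
  refine ⟨⟨?_, ?_, ?_, ?_⟩, hFI⟩
  · rw [intervalIntegrable_iff] at ui ⊢
    have := (innerSL ℝ (v k)).integrable_comp ui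
    refine this.congr (Eventually.of_forall fun x => ?_)
    simp [hw, real_inner_comm]
  · exact ucoo.inner continuousOn_const
  · intro s hs hne
    refine Dv s hs (dif s hs fun h0 => hne ?_)
    simp [hw, h0]
  · intro p q hp hpq hqT hz
    have hex : ∃ p' q', p < p' ∧ p' < q' ∧ q' < q ∧ ∀ s ∈ Icc p' q', DifferentiableAt ℝ (FI ρ u) s := by
      by_cases hu : ∃ s ∈ Ioo p q, u s ≠ 0
      · obtain ⟨s, hs, hne⟩ := hu
        have hcat : ContinuousAt u s :=
          ucoo.continuousAt (Ioo_mem_nhds (by linarith [hs.1]) (by linarith [hs.2]))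
        have hev : ∀ᶠ x in 𝓝[≥] s, u x ≠ 0 := (hcat.eventually_ne hne).filter_mono nhdsWithin_le_nhds
        obtain ⟨l, hl1, hl2⟩ := mem_nhdsGE_iff_exists_Ico_subset.1 hev
        have hm : s < min l q := lt_min hl1 hs.2
        refine ⟨s, (s + min l q) / 2, hs.1, by linarith, by linarith [min_le_right l q], ?_⟩
        intro x hx
        refine dif x ⟨by linarith [hx.1, hs.1], by linarith [hx.2, min_le_right l q]⟩ ?_
        exact hl2 ⟨hx.1, by linarith [hx.2, min_le_left l q]⟩
      · push Not at hu
        refine ⟨p + (q - p) / 3, p + 2 * (q - p) / 3, by linarith, by linarith, by linarith, ?_⟩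
        intro x hx
        have hd := hist_deriv (a := -ρ) hp.le (by linarith [hx.1] : p < x)
          (ii_sub ui le_rfl hp.le (by linarith))
        refine (hd.congr_of_eventuallyEq ?_).differentiableAt
        filter_upwards [Ioo_mem_nhds (by linarith [hx.1] : p < x) (by linarith [hx.2] : x < q)] with y hy
        rw [FI_split h1 hp hy.1 (ii_sub ui le_rfl (by linarith [hy.1]) (by linarith [hy.2]))
          (ucoo.mono fun z hz => ⟨hz.1, by linarith [hz.2, hy.2]⟩)]
        rw [intervalIntegral.integral_congr_ae (a := p) (g := fun _ => (0:H))]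
        · simp
        · refine Eventually.of_forall fun z hz => ?_
          rw [uIoc_of_le hy.1.le] at hz
          rw [hu z ⟨hz.1, by linarith [hz.2, hy.2]⟩, smul_zero]
    obtain ⟨p', q', a, b, c, hd⟩ := hex
    refine ⟨p', q', a, b, c, ?_⟩
    have hD : ∀ x ∈ Icc p' q', HasDerivAt (FI ρ w) 0 x := by
      intro x hx
      have := Dv x ⟨by linarith [hx.1], by linarith [hx.2]⟩ (hd x hx)
      rwa [hz x ⟨by linarith [hx.1], by linarith [hx.2]⟩, mul_zero] at this
    exact (constant_of_has_deriv_right_zero (fun x hx => (hD x hx).continuousAt.continuousWithinAt)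
      (fun x hx => (hD x ⟨hx.1, hx.2.le⟩).hasDerivWithinAt) q' ⟨b.le, le_rfl⟩).symm

lemma main_aux (v : HilbertBasis ℕ ℝ H) (lam : ℕ → ℝ) (hlam1 : 0 < lam 0) (hmono : Monotone lam)
    {ρ : ℝ} (h0 : 0 < ρ) (h1 : ρ < 1) {T : ℝ} (hT : 0 < T) (φ : H) (Aop : H → H)
    (hA : Aop = fun h : H => ∑' k : ℕ, (lam k * ⟪h, v k⟫) • v k)
    (u₁ u₂ : ℝ → H)
    (hdom₁ : ∀ t ∈ Ioc (0 : ℝ) T, Summable (fun k : ℕ => (lam k) ^ 2 * ⟪u₁ t, v k⟫ ^ 2))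
    (hdom₂ : ∀ t ∈ Ioc (0 : ℝ) T, Summable (fun k : ℕ => (lam k) ^ 2 * ⟪u₂ t, v k⟫ ^ 2))
    (hAcont₁ : ContinuousOn (fun t : ℝ => Aop (u₁ t)) (Ioc (0 : ℝ) T))
    (hAcont₂ : ContinuousOn (fun t : ℝ => Aop (u₂ t)) (Ioc (0 : ℝ) T))
    (heq₁ : ∀ t ∈ Ioc (0 : ℝ) T, rlDeriv ρ u₁ t + Aop (u₁ t) = 0)
    (heq₂ : ∀ t ∈ Ioc (0 : ℝ) T, rlDeriv ρ u₂ t + Aop (u₂ t) = 0)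
    (hinit₁ : Tendsto (fun t : ℝ => rlIntegral (1 - ρ) u₁ t) (𝓝[>] 0) (𝓝 φ))
    (hinit₂ : Tendsto (fun t : ℝ => rlIntegral (1 - ρ) u₂ t) (𝓝[>] 0) (𝓝 φ)) :
    ∀ t ∈ Ioc (0 : ℝ) T, u₁ t = u₂ t := by
  obtain ⟨c1, s1⟩ := vec_sol v lam hlam1 hmono h1 hT Aop hA u₁ hdom₁ hAcont₁ heq₁
  obtain ⟨c2, s2⟩ := vec_sol v lam hlam1 hmono h1 hT Aop hA u₂ hdom₂ hAcont₂ heq₂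
  have lim : ∀ (u : ℝ → H) (k : ℕ), Tendsto (fun t : ℝ => rlIntegral (1 - ρ) u t) (𝓝[>] 0) (𝓝 φ) →
      (∀ s ∈ Ioo 0 T, FI ρ (fun t => ⟪u t, v k⟫) s = ⟪FI ρ u s, v k⟫) →
      Tendsto (FI ρ (fun t => ⟪u t, v k⟫)) (𝓝[>] 0) (𝓝 ⟪Real.Gamma (1 - ρ) • φ, v k⟫) := by
    intro u k hi hF
    have t1 := (hi.const_smul (Real.Gamma (1 - ρ))).inner (tendsto_const_nhds (x := v k)) (𝕜 := ℝ)
    refine t1.congr' ?_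
    filter_upwards [Ioo_mem_nhdsGT hT] with s hs
    rw [hF s hs, FI_rl h1]
  have main : ∀ t ∈ Ioo 0 T, u₁ t = u₂ t := by
    intro t ht
    refine sub_eq_zero.1 (comp_zero v fun k => ?_)
    have hlk : 0 < lam k * Real.Gamma (1 - ρ) :=
      mul_pos (hlam1.trans_le (hmono (Nat.zero_le k))) (Real.Gamma_pos_of_pos (by linarith))
    have := scal_uniq h0 h1 hlk (s1 k).1 (s2 k).1 (lim u₁ k hinit₁ (s1 k).2) (lim u₂ k hinit₂ (s2 k).2) t ht
    rw [inner_sub_left]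
    exact sub_eq_zero.2 this
  intro t ht
  rcases eq_or_lt_of_le ht.2 with e | e
  · subst e
    have : (𝓝[Ioo 0 t] t).NeBot := by
      rw [nhdsWithin_Ioo_eq_nhdsLT ht.1]; infer_instance
    have a1 : Tendsto u₁ (𝓝[Ioo 0 t] t) (𝓝 (u₁ t)) := (c1 t ht).mono Ioo_subset_Ioc_self
    have a2 : Tendsto u₂ (𝓝[Ioo 0 t] t) (𝓝 (u₂ t)) := (c2 t ht).mono Ioo_subset_Ioc_self
    refine tendsto_nhds_unique a1 (a2.congr' ?_)
    filter_upwards [self_mem_nhdsWithin] with s hs using (main s hs).symm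
  · exact main t ⟨ht.1, e⟩

end

end Helpers

/-- Uniqueness for the forward problem: if `u₁`, `u₂` both solve
`∂_t^ρ u + Au = 0` on `(0,T]` with `∂_t^{ρ-1} u(t) → φ` as `t → 0⁺` (each having
`∂_t^ρ u` and `Au` continuous on `(0,T]`, with `u(t)` in the domain of `A`), then
`u₁ = u₂` on `(0,T]`. -/
theorem statement1
    {H : Type*} [NormedAddCommGroup H] [InnerProductSpace ℝ H] [CompleteSpace H]
    (v : HilbertBasis ℕ ℝ H) (lam : ℕ → ℝ) (hlam1 : 0 < lam 0) (hmono : Monotone lam)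
    (ρ : ℝ) (hρ : ρ ∈ Set.Ioo (0 : ℝ) 1) (T : ℝ) (hT : 0 < T) (φ : H)
    (Aop : H → H)
    (hA : Aop = fun h : H => ∑' k : ℕ, (lam k * ⟪h, v k⟫) • v k)
    (u₁ u₂ : ℝ → H)
    (hdom₁ : ∀ t ∈ Set.Ioc (0 : ℝ) T, Summable (fun k : ℕ => (lam k) ^ 2 * ⟪u₁ t, v k⟫ ^ 2))
    (hdom₂ : ∀ t ∈ Set.Ioc (0 : ℝ) T, Summable (fun k : ℕ => (lam k) ^ 2 * ⟪u₂ t, v k⟫ ^ 2))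
    (hAcont₁ : ContinuousOn (fun t : ℝ => Aop (u₁ t)) (Set.Ioc (0 : ℝ) T))
    (hAcont₂ : ContinuousOn (fun t : ℝ => Aop (u₂ t)) (Set.Ioc (0 : ℝ) T))
    (hDcont₁ : ContinuousOn (fun t : ℝ => rlDeriv ρ u₁ t) (Set.Ioc (0 : ℝ) T))
    (hDcont₂ : ContinuousOn (fun t : ℝ => rlDeriv ρ u₂ t) (Set.Ioc (0 : ℝ) T))
    (heq₁ : ∀ t ∈ Set.Ioc (0 : ℝ) T, rlDeriv ρ u₁ t + Aop (u₁ t) = 0)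
    (heq₂ : ∀ t ∈ Set.Ioc (0 : ℝ) T, rlDeriv ρ u₂ t + Aop (u₂ t) = 0)
    (hinit₁ : Tendsto (fun t : ℝ => rlIntegral (1 - ρ) u₁ t)
      (nhdsWithin 0 (Set.Ioi 0)) (nhds φ))
    (hinit₂ : Tendsto (fun t : ℝ => rlIntegral (1 - ρ) u₂ t)
      (nhdsWithin 0 (Set.Ioi 0)) (nhds φ)) :
    ∀ t ∈ Set.Ioc (0 : ℝ) T, u₁ t = u₂ t := by
  exact main_aux v lam hlam1 hmono hρ.1 hρ.2 hT φ Aop hA u₁ u₂ hdom₁ hdom₂ hAcont₁ hAcont₂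
    heq₁ heq₂ hinit₁ hinit₂
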